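/- Fix σ > 0 and let p = p(m) satisfy m·p(m)^{2/3} → σ as m → ∞. Then P[X_m and X_m* have different strongly connected components] → 0 as m → ∞. -/

import Mathlib

open Finset
open scoped Classical

namespace RandomTree

/-- The state of the depth-first exploration: the ordered stack of open vertices and the
list of explored vertices, in order of exploration. -/
structure St (m : ℕ) where
  stack : List (Fin m)
  visited : List (Fin m)

/-- One step of the depth-first exploration of the graph with adjacency `adj`. -/
def step {m : ℕ} (adj : Fin m → Fin m → Bool) (s : St m) : St m :=
  match s.stack with
  | [] => s
  | v :: rest =>
    let visited' := s.visited ++ [v]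
    let ns := (List.finRange m).filter
      (fun w => adj v w && !(decide (w ∈ s.stack)) && !(decide (w ∈ s.visited)))
    let stack' := ns ++ rest
    let stack'' := if stack'.isEmpty then
        ((List.finRange m).filter (fun w => !(decide (w ∈ visited')))).take 1
      else stack'
    ⟨stack'', visited', ⟩

/-- The state of the depth-first exploration started at the root `r` after `i` steps. -/
def stateAt {m : ℕ} (adj : Fin m → Fin m → Bool) (r : Fin m) (i : ℕ) : St m :=
  (step adj)^[i] ⟨[r], []⟩

/-- `par` is the parent map of a tree on `Fin m` rooted at `r`: iterating the parent map
from any vertex leads to the root. -/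
def IsPTree {m : ℕ} (par : Fin m → Fin m) (r : Fin m) : Prop :=
  par r = r ∧ ∀ v, ∃ k : ℕ, par^[k] v = r

/-- The set of (parent maps of) labelled trees on `Fin m` rooted at `r`. -/
noncomputable def treeFinset (m : ℕ) (r : Fin m) : Finset (Fin m → Fin m) :=
  univ.filter (fun par => IsPTree par r)

/-- The adjacency function of the canonical plane embedding of the tree with parent map
`par`: edges from each vertex to its children (children are listed in increasing order of
label by the exploration itself). -/
def childAdj {m : ℕ} (par : Fin m → Fin m) (r : Fin m) : Fin m → Fin m → Bool :=
  fun v w => decide (w ≠ r) && decide (par w = v)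

/-- The depth-first (planar) order of the vertices of the tree, as a list
`[v₁, …, v_m]`. -/
def dfsOrder {m : ℕ} (par : Fin m → Fin m) (r : Fin m) : List (Fin m) :=
  (stateAt (childAdj par r) r m).visited

/-- The position of a vertex in the depth-first (planar) order. -/
def dfsPos {m : ℕ} (par : Fin m → Fin m) (r : Fin m) (v : Fin m) : ℕ :=
  (dfsOrder par r).findIdx (fun w => decide (w = v))

/-- The number of vertices of the subtree rooted at `v` (including `v`). -/
noncomputable def subSize {m : ℕ} (par : Fin m → Fin m) (v : Fin m) : ℕ :=
  Set.ncard {w : Fin m | ∃ k : ℕ, par^[k] w = v}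

/-- The number of vertices of the subtree rooted at `v` lying outside the largest of the
subtrees rooted at a child of `v`. -/
noncomputable def outsideLargest {m : ℕ} (par : Fin m → Fin m) (r : Fin m) (v : Fin m) : ℕ :=
  subSize par v - (univ.filter (fun c : Fin m => c ≠ r ∧ par c = v)).sup (subSize par)


/-- The permitted edges of the plane tree with parent map `par`: ordered pairs `(u, v)`
of distinct vertices, with `u` before `v` in the planar order (so `u` is the tail and `v`
the head), which at some step of the depth-first exploration are simultaneously on the
stack. -/
noncomputable def permitted {m : ℕ} (par : Fin m → Fin m) (r : Fin m) :
    Finset (Fin m × Fin m) :=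
  univ.filter (fun x : Fin m × Fin m => x.1 ≠ x.2 ∧
    dfsPos par r x.1 < dfsPos par r x.2 ∧
    ∃ i ≤ m, x.1 ∈ (stateAt (childAdj par r) r i).stack ∧
      x.2 ∈ (stateAt (childAdj par r) r i).stack)

/-- The probability weight of a configuration `s` of surplus edges: each permitted edge
is added independently with probability `p`; configurations containing a non-permitted
edge get weight `0`. -/
noncomputable def surpW {m : ℕ} (p : ℝ) (par : Fin m → Fin m) (r : Fin m)
    (s : Fin m → Fin m → Bool) : ℝ :=
  if ∀ u w, s u w = true → (u, w) ∈ permitted par r then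
    ∏ x ∈ permitted par r, (if s x.1 x.2 then p else 1 - p)
  else 0

/-- The number `a(T)` of permitted edges ("area") of the plane tree with parent map `par`. -/
noncomputable def area {m : ℕ} (par : Fin m → Fin m) (r : Fin m) : ℕ :=
  (permitted par r).card

/-- The height of the vertex `v`: its distance to the root. -/
noncomputable def hgt {m : ℕ} (par : Fin m → Fin m) (r : Fin m) (v : Fin m) : ℕ :=
  sInf {k : ℕ | par^[k] v = r}

/-- The height `‖T‖` of the tree: the largest distance from the root to a vertex. -/
noncomputable def treeHeight {m : ℕ} (par : Fin m → Fin m) (r : Fin m) : ℕ :=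
  univ.sup (hgt par r)


/-- The probability weight of a configuration `b` of back edges: each pair `(vᵢ, vⱼ)`
with `j < i` in the planar order is a back edge independently with probability `p`;
configurations containing a non-backward pair get weight `0`. -/
noncomputable def backW {m : ℕ} (p : ℝ) (par : Fin m → Fin m) (r : Fin m)
    (b : Fin m → Fin m → Bool) : ℝ :=
  if ∀ u w, b u w = true → dfsPos par r w < dfsPos par r u then
    ∏ x ∈ univ.filter (fun x : Fin m × Fin m => dfsPos par r x.2 < dfsPos par r x.1),
      (if b x.1 x.2 then p else 1 - p)
  else 0

/-- The probability weight of the tree `par` under the biased law of `T_m`: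
proportional to `(1-p)^{-a(par)}` on trees, `0` on non-trees. -/
noncomputable def biasW {m : ℕ} (p : ℝ) (par : Fin m → Fin m) (r : Fin m) : ℝ :=
  if IsPTree par r then ((1 - p) ^ area par r)⁻¹ else 0

/-- `u` is an ancestor of `v` (inclusively) in the tree with parent map `par`. -/
def Anc {m : ℕ} (par : Fin m → Fin m) (u v : Fin m) : Prop :=
  ∃ k : ℕ, par^[k] v = u

/-- The set of back edges present in the configuration `b`. -/
noncomputable def backFinset {m : ℕ} (b : Fin m → Fin m → Bool) :
    Finset (Fin m × Fin m) :=
  univ.filter (fun x : Fin m × Fin m => b x.1 x.2 = true)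

/-- The lexicographic key (by planar order of the tail, then of the head) used to order
the back edges. -/
noncomputable def lexKey {m : ℕ} (par : Fin m → Fin m) (r : Fin m)
    (x : Fin m × Fin m) : Lex (ℕ × ℕ) :=
  toLex (dfsPos par r x.1, dfsPos par r x.2)

/-- One step of the marking procedure on the set `B` of back edges: among the unmarked
elements `(x, y)` of `B` such that `y` lies on the union of the paths from the root to
`x` and to the tails of the already marked edges, mark the lexicographically smallest
(for the planar order) one, if any. -/
noncomputable def markStep {m : ℕ} (par : Fin m → Fin m) (r : Fin m)
    (B : Finset (Fin m × Fin m)) (marked : Finset (Fin m × Fin m)) :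
    Finset (Fin m × Fin m) :=
  let cands := (B \ marked).filter
    (fun x => Anc par x.2 x.1 ∨ ∃ y ∈ marked, Anc par x.2 y.1)
  if h : cands.Nonempty then
    marked ∪ cands.filter
      (fun x => lexKey par r x = (cands.image (lexKey par r)).min' (h.image _))
  else marked

/-- The marked subset `((x_{i,m}, y_{i,m}), i ≤ N_m)` of the back edges of the
configuration `b`. -/
noncomputable def markedEdges {m : ℕ} (par : Fin m → Fin m) (r : Fin m)
    (b : Fin m → Fin m → Bool) : Finset (Fin m × Fin m) :=
  (markStep par r (backFinset b))^[(backFinset b).card] ∅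

/-- The edge relation of the random directed graph `X_m`: the tree edges (directed away
from the root), the back edges of `b` and the surplus edges of `s`. -/
def edgeX {m : ℕ} (par : Fin m → Fin m) (r : Fin m)
    (b s : Fin m → Fin m → Bool) (a c : Fin m) : Prop :=
  (c ≠ r ∧ par c = a) ∨ b a c = true ∨ s a c = true

/-- The edge relation of `X_m*`: the tree edges together with the marked back edges only
(all surplus edges and unmarked back edges removed). -/
def edgeXstar {m : ℕ} (par : Fin m → Fin m) (r : Fin m)
    (b : Fin m → Fin m → Bool) (a c : Fin m) : Prop :=
  (c ≠ r ∧ par c = a) ∨ (a, c) ∈ markedEdges par r b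

/-- Two vertices lie in the same strongly connected component of the directed graph with
edge relation `E`. -/
def SameSCC {m : ℕ} (E : Fin m → Fin m → Prop) (u v : Fin m) : Prop :=
  Relation.ReflTransGen E u v ∧ Relation.ReflTransGen E v u

/-- The directed graphs with edge relations `E` and `E'` (on the same vertex set) have
the same strongly connected components: they induce the same partition into strongly
connected components, and each component carries the same edges in both. -/
def SameSCCs {m : ℕ} (E E' : Fin m → Fin m → Prop) : Prop :=
  (∀ u v, SameSCC E u v ↔ SameSCC E' u v) ∧
  (∀ u v, (E u v ∧ SameSCC E u v) ↔ (E' u v ∧ SameSCC E' u v))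

/-- The probability, under the law of `(T_m, X_m)` (the tree biased by `(1-p)^{-a(·)}`,
back edges and surplus edges added independently with probability `p`), of the event
`ev`. -/
noncomputable def modelProb (m : ℕ) (p : ℝ)
    (ev : ∀ m' : ℕ, (Fin m' → Fin m') → Fin m' →
      (Fin m' → Fin m' → Bool) → (Fin m' → Fin m' → Bool) → Prop) : ℝ :=
  if h : 0 < m then
    let r : Fin m := ⟨0, h⟩
    (∑ par : Fin m → Fin m, ∑ b : Fin m → Fin m → Bool, ∑ s : Fin m → Fin m → Bool,
      biasW p par r * backW p par r b * surpW p par r s *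
        (if ev m par r b s then 1 else 0))
      / (∑ par : Fin m → Fin m, biasW p par r)
  else 0

end RandomTree

namespace RandomTree

section Forests

variable {V : Type*}

/-- Iterating `g` from `x` leads to `y`. -/
def Below (g : V → V) (x y : V) : Prop := ∃ k : ℕ, g^[k] x = y

theorem Below.refl (g : V → V) (x : V) : Below g x x := ⟨0, rfl⟩

theorem Below.trans {g : V → V} {x y w : V} (h : Below g x y) (h' : Below g y w) :
    Below g x w := by
  obtain ⟨k, rfl⟩ := h
  obtain ⟨l, rfl⟩ := h'
  exact ⟨l + k, by rw [Function.iterate_add_apply]⟩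

theorem Below.step (g : V → V) (x : V) : Below g x (g x) := ⟨1, rfl⟩

theorem Below.cases_step {g : V → V} {x y : V} (h : Below g x y) : x = y ∨ Below g (g x) y := by
  obtain ⟨k, hk⟩ := h
  cases k with
  | zero => exact Or.inl hk
  | succ k => exact Or.inr ⟨k, by rwa [Function.iterate_succ_apply] at hk⟩

theorem Below.cases_last {g : V → V} {x y : V} (h : Below g x y) :
    x = y ∨ ∃ w, w ≠ y ∧ g w = y ∧ Below g x w := by
  obtain ⟨k, hk⟩ := h
  induction k with
  | zero => exact Or.inl hk
  | succ k ih =>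
    rw [Function.iterate_succ_apply'] at hk
    by_cases h : g^[k] x = y
    · exact ih h
    · exact Or.inr ⟨_, h, hk, k, rfl⟩

theorem Below.eq_of_fixed {g : V → V} {x y : V} (h : Below g x y) (hx : g x = x) : y = x := by
  obtain ⟨k, rfl⟩ := h
  exact Function.iterate_fixed hx k

theorem Below.total {g : V → V} {x y w : V} (h : Below g x y) (h' : Below g x w) :
    Below g y w ∨ Below g w y := by
  obtain ⟨k, rfl⟩ := h
  obtain ⟨l, rfl⟩ := h'
  rcases le_total k l with hkl | hkl
  · exact Or.inl ⟨l - k, by rw [← Function.iterate_add_apply, Nat.sub_add_cancel hkl]⟩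
  · exact Or.inr ⟨k - l, by rw [← Function.iterate_add_apply, Nat.sub_add_cancel hkl]⟩

/-- If `g` and `g'` agree away from `v`, a path of `g` is a path of `g'` until it meets `v`. -/
theorem Below.transfer {g g' : V → V} {v : V} (hg : ∀ x, x ≠ v → g x = g' x) {x y : V}
    (h : Below g x y) : Below g' x y ∨ (Below g' x v ∧ Below g v y) := by
  obtain ⟨k, hk⟩ := h
  induction k generalizing x with
  | zero => exact Or.inl ⟨0, hk⟩
  | succ k ih =>
    by_cases hx : x = v
    · subst hx
      exact Or.inr ⟨Below.refl _ _, _, hk⟩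
    · rw [Function.iterate_succ_apply] at hk
      have hs : Below g' x (g x) := by rw [hg x hx]; exact Below.step _ _
      rcases ih hk with h | ⟨h, h'⟩
      · exact Or.inl (hs.trans h)
      · exact Or.inr ⟨hs.trans h, h'⟩

/-- A periodic point leading to a fixed point is that fixed point. -/
theorem Below.eq_of_cycle {g : V → V} {v ρ : V} (hρ : g ρ = ρ) (h : Below g v ρ)
    (hc : Below g (g v) v) : v = ρ := by
  obtain ⟨j, hj⟩ := h
  induction j generalizing v with
  | zero => exact hj
  | succ j ih =>
    rw [Function.iterate_succ_apply] at hj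
    have := ih (v := g v) (by
      obtain ⟨k, hk⟩ := hc
      refine ⟨k, ?_⟩
      rw [← Function.iterate_succ_apply, Function.iterate_succ_apply', hk]) hj
    rw [this] at hc
    exact hc.eq_of_fixed hρ

/-- The vertices of the subtree below `ρ`. -/
noncomputable def descend [Fintype V] (g : V → V) (ρ : V) : Finset V :=
  univ.filter (fun x => Below g x ρ)

theorem mem_descend [Fintype V] {g : V → V} {ρ x : V} : x ∈ descend g ρ ↔ Below g x ρ := by
  simp [descend]

/-- `g` is the parent map of a forest with root set `R`. -/
def IsForest (R : Finset V) (g : V → V) : Prop :=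
  (∀ x ∈ R, g x = x) ∧ ∀ x, ∃ ρ ∈ R, Below g x ρ

variable [DecidableEq V]

theorem IsForest.detach {R : Finset V} {g : V → V} (hg : IsForest R g) (v : V) :
    IsForest (insert v R) (Function.update g v v) := by
  constructor
  · intro x hx
    by_cases h : x = v
    · subst h; simp
    · rw [Function.update_of_ne h]
      exact hg.1 x (by simpa [h] using hx)
  · intro x
    obtain ⟨ρ, hρ, h⟩ := hg.2 x
    rcases h.transfer (g' := Function.update g v v) (v := v)
      (fun x hx => by rw [Function.update_of_ne hx]) with h | ⟨h, -⟩
    · exact ⟨ρ, by simp [hρ], h⟩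
    · exact ⟨v, by simp, h⟩

theorem IsForest.not_below_detach {R : Finset V} {g : V → V} (hg : IsForest R g) {v : V}
    (hv : v ∉ R) : ¬ Below (Function.update g v v) (g v) v := by
  intro h
  obtain ⟨ρ, hρ, hb⟩ := hg.2 v
  have : Below g (g v) v := by
    rcases h.transfer (g' := g) (v := v)
      (fun x hx => by rw [Function.update_of_ne hx]) with h | ⟨h, -⟩ <;> exact h
  exact hv (Below.eq_of_cycle (hg.1 ρ hρ) hb this ▸ hρ)

theorem IsForest.attach {R : Finset V} {g : V → V} {v y : V} (hv : v ∉ R)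
    (hg : IsForest (insert v R) g) (hy : ¬ Below g y v) :
    IsForest R (Function.update g v y) := by
  have hag : ∀ x, x ≠ v → g x = Function.update g v y x :=
    fun x hx => by rw [Function.update_of_ne hx]
  have key : ∀ x, ¬ Below g x v → ∃ ρ ∈ R, Below (Function.update g v y) x ρ := by
    intro x hx
    obtain ⟨ρ, hρ, h⟩ := hg.2 x
    have hne : ρ ≠ v := fun h' => hx (h' ▸ h)
    rcases h.transfer hag with h' | ⟨h1, h2⟩
    · exact ⟨ρ, by simpa [hne] using hρ, h'⟩
    · exact absurd (h2.eq_of_fixed (hg.1 v (by simp))) hne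
  constructor
  · intro x hx
    rw [Function.update_of_ne (by rintro rfl; exact hv hx)]
    exact hg.1 x (by simp [hx])
  · intro x
    by_cases hx : Below g x v
    · have h1 : Below (Function.update g v y) x v := by
        rcases hx.transfer hag with h | ⟨h, -⟩ <;> exact h
      obtain ⟨ρ, hρ, h⟩ := key y hy
      refine ⟨ρ, hρ, h1.trans (Below.trans ⟨1, ?_⟩ h)⟩
      simp
    · exact key x hx

theorem below_attach_iff {R : Finset V} {g : V → V} {v y ρ : V} (hv : v ∉ R)
    (hg : IsForest (insert v R) g) (hy : ¬ Below g y v) (hρ : ρ ∈ R) (x : V) :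
    Below (Function.update g v y) x ρ ↔ Below g x ρ ∨ (Below g y ρ ∧ Below g x v) := by
  have hag : ∀ x, x ≠ v → g x = Function.update g v y x :=
    fun x hx => by rw [Function.update_of_ne hx]
  have hag' : ∀ x, x ≠ v → Function.update g v y x = g x :=
    fun x hx => by rw [Function.update_of_ne hx]
  have hne : ρ ≠ v := by rintro rfl; exact hv hρ
  have hvy : Below (Function.update g v y) v y := ⟨1, by simp⟩
  have up : ∀ x, Below g x ρ → Below (Function.update g v y) x ρ := by
    intro x h
    rcases h.transfer hag with h | ⟨-, h2⟩
    · exact h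
    · exact absurd (h2.eq_of_fixed (hg.1 v (by simp))) hne
  constructor
  · intro h
    rcases h.transfer hag' with h | ⟨h1, h2⟩
    · exact Or.inl h
    · refine Or.inr ⟨?_, h1⟩
      rcases h2.cases_step with h | h
      · exact absurd h.symm hne
      · rw [Function.update_self] at h
        rcases h.transfer hag' with h | ⟨h, -⟩
        · exact h
        · exact absurd h hy
  · rintro (h | ⟨h1, h2⟩)
    · exact up x h
    · have : Below (Function.update g v y) x v := by
        rcases h2.transfer hag with h | ⟨h, -⟩ <;> exact h
      exact (this.trans hvy).trans (up y h1)

variable [Fintype V]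

/-- The parent maps of forests with root set `R`. -/
noncomputable def forests (R : Finset V) : Finset (V → V) := univ.filter (IsForest R)

theorem mem_forests {R : Finset V} {g : V → V} : g ∈ forests R ↔ IsForest R g := by
  simp [forests]

theorem sum_forests_eq_sum_attach {R : Finset V} {v : V} (hv : v ∉ R) (Φ : (V → V) → ℝ) :
    ∑ g ∈ forests R, Φ g =
      ∑ g ∈ forests (insert v R), ∑ y ∈ (descend g v)ᶜ, Φ (Function.update g v y) := by
  rw [Finset.sum_sigma']
  refine Finset.sum_bij' (fun g _ => ⟨Function.update g v v, g v⟩)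
    (fun x _ => Function.update x.1 v x.2) ?_ ?_ ?_ ?_ ?_
  · intro g hg
    rw [mem_forests] at hg
    simp only [mem_sigma, mem_forests, mem_compl, mem_descend]
    exact ⟨hg.detach v, hg.not_below_detach hv⟩
  · rintro ⟨g, y⟩ hg
    simp only [mem_sigma, mem_forests, mem_compl, mem_descend] at hg ⊢
    exact hg.1.attach hv hg.2
  · intro g hg
    simp
  · rintro ⟨g, y⟩ hg
    simp only [mem_sigma, mem_forests, mem_compl, mem_descend] at hg
    have : g v = v := hg.1.1 v (by simp)
    simp only [Function.update_idem, Function.update_self, Sigma.mk.injEq, heq_eq_eq, and_true]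
    rw [Function.update_eq_self_iff]
    exact this.symm
  · intro g hg
    simp

/-- Weighted forest enumeration, refined by the weight of the tree of a given root. -/
theorem sum_forests_mul_descend (z : V → ℝ) (R : Finset V) (ρ : V) (hρ : ρ ∈ R) :
    ∑ g ∈ forests R, (∏ v ∈ Rᶜ, z (g v)) * ∑ x ∈ descend g ρ, z x
      = z ρ * (∑ x, z x) ^ #Rᶜ := by
  induction hn : #Rᶜ generalizing R with
  | zero =>
    have hR : R = univ := by simpa using hn
    subst hR
    have hf : forests (univ : Finset V) = {id} := by
      ext g
      rw [mem_forests, mem_singleton]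
      constructor
      · intro h; ext x; exact h.1 x (mem_univ x)
      · rintro rfl
        exact ⟨fun _ _ => rfl, fun x => ⟨x, mem_univ x, Below.refl _ _⟩⟩
    have hd : descend (id : V → V) ρ = {ρ} := by
      ext x
      simp [mem_descend, Below]
    simp [hf, hd]
  | succ n ih =>
    obtain ⟨v, hv⟩ : (Rᶜ).Nonempty := by rw [← card_pos]; omega
    have hvR : v ∉ R := by simpa using hv
    have hcompl : Rᶜ = insert v (insert v R)ᶜ := by
      ext x
      by_cases h : x = v <;> simp [h, hvR]
    have hcard : #(insert v R)ᶜ = n := by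
      rw [hcompl, card_insert_of_notMem (by simp)] at hn
      omega
    have hne : ρ ≠ v := fun h => hvR (h ▸ hρ)
    rw [sum_forests_eq_sum_attach hvR]
    have key : ∀ g ∈ forests (insert v R),
        ∑ y ∈ (descend g v)ᶜ, (∏ x ∈ Rᶜ, z (Function.update g v y x)) *
            ∑ x ∈ descend (Function.update g v y) ρ, z x
          = ((∏ x ∈ (insert v R)ᶜ, z (g x)) * ∑ x ∈ descend g ρ, z x) * ∑ x, z x := by
      intro g hg
      rw [mem_forests] at hg
      have hdisj : Disjoint (descend g ρ) (descend g v) := by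
        rw [Finset.disjoint_left]
        intro x h1 h2
        rw [mem_descend] at h1 h2
        rcases h1.total h2 with h | h
        · exact hne (h.eq_of_fixed (hg.1 ρ (by simp [hρ]))).symm
        · exact hne (h.eq_of_fixed (hg.1 v (by simp)))
      have hterm : ∀ y ∈ (descend g v)ᶜ, (∏ x ∈ Rᶜ, z (Function.update g v y x)) *
            ∑ x ∈ descend (Function.update g v y) ρ, z x
          = (∏ x ∈ (insert v R)ᶜ, z (g x)) * (z y * (∑ x ∈ descend g ρ, z x) +
            if y ∈ descend g ρ then z y * ∑ x ∈ descend g v, z x else 0) := by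
        intro y hy
        rw [mem_compl, mem_descend] at hy
        have h1 : ∏ x ∈ Rᶜ, z (Function.update g v y x)
            = z y * ∏ x ∈ (insert v R)ᶜ, z (g x) := by
          rw [hcompl, prod_insert (by simp), Function.update_self]
          congr 1
          apply prod_congr rfl
          intro x hx
          rw [Function.update_of_ne]
          rintro rfl
          simp at hx
        have h2 : descend (Function.update g v y) ρ =
            descend g ρ ∪ (if y ∈ descend g ρ then descend g v else ∅) := by
          ext x
          rw [mem_descend, below_attach_iff hvR hg hy hρ, mem_union, mem_descend]
          by_cases h : Below g y ρ <;> simp [h, mem_descend]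
        rw [h1, h2, sum_union]
        · split_ifs <;> simp <;> ring
        · split_ifs
          · exact hdisj
          · simp
      rw [sum_congr rfl hterm, ← mul_sum, sum_add_distrib, ← sum_mul, mul_assoc]
      congr 1
      have h3 : ∑ y ∈ (descend g v)ᶜ,
          (if y ∈ descend g ρ then z y * ∑ x ∈ descend g v, z x else 0)
          = (∑ y ∈ descend g ρ, z y) * ∑ x ∈ descend g v, z x := by
        rw [← sum_filter, sum_mul]
        apply sum_congr _ (fun _ _ => rfl)
        ext x
        simp only [mem_filter, mem_compl]
        exact ⟨fun h => h.2, fun h => ⟨Finset.disjoint_left.1 hdisj h, h⟩⟩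
      rw [h3, ← Finset.sum_compl_add_sum (descend g v) z]
      ring
    rw [sum_congr rfl key, ← sum_mul, ih (insert v R) (by simp [hρ]) hcard, pow_succ]
    ring

/-- Weighted forest enumeration. -/
theorem sum_forests (z : V → ℝ) (R : Finset V) :
    (∑ g ∈ forests R, ∏ v ∈ Rᶜ, z (g v)) * ∑ x, z x
      = (∑ ρ ∈ R, z ρ) * (∑ x, z x) ^ #Rᶜ := by
  rw [sum_mul, sum_mul, ← sum_congr rfl (fun ρ hρ => sum_forests_mul_descend z R ρ hρ), sum_comm]
  apply sum_congr rfl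
  intro g hg
  rw [mem_forests] at hg
  rw [← mul_sum]
  congr 1
  rw [← sum_biUnion]
  · apply sum_congr _ (fun _ _ => rfl)
    ext x
    simpa [mem_descend] using hg.2 x
  · intro a ha b hb hab
    rw [Function.onFun, Finset.disjoint_left]
    intro x h1 h2
    rw [mem_descend] at h1 h2
    rcases h1.total h2 with h | h
    · exact hab (h.eq_of_fixed (hg.1 a ha)).symm
    · exact hab (h.eq_of_fixed (hg.1 b hb))

/-- Cayley's formula. -/
theorem card_forests_singleton (r : V) :
    (#(forests {r}) : ℝ) * (Fintype.card V : ℝ) ^ 2 = (Fintype.card V : ℝ) ^ Fintype.card V := by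
  have h := sum_forests (fun _ => (1 : ℝ)) {r}
  have hpos : 0 < Fintype.card V := Fintype.card_pos_iff.2 ⟨r⟩
  simp only [prod_const_one, sum_const, nsmul_eq_mul, mul_one, card_univ, card_singleton,
    card_compl, Nat.cast_one, one_mul] at h
  rw [pow_two, ← mul_assoc, h, ← pow_succ]
  congr 1
  omega

end Forests
end RandomTree

namespace RandomTree

section Paths

theorem sum_biUnion_le_of_nonneg {ι α : Type*} [DecidableEq α] {f : α → ℝ}
    (hf : ∀ a, 0 ≤ f a) (s : Finset ι) (t : ι → Finset α) :
    ∑ a ∈ s.biUnion t, f a ≤ ∑ i ∈ s, ∑ a ∈ t i, f a := by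
  induction s using Finset.induction_on with
  | empty => simp
  | insert i s hi ih =>
    rw [biUnion_insert, sum_insert hi]
    have h := sum_union_inter (s₁ := t i) (s₂ := s.biUnion t) (f := f)
    have h' : 0 ≤ ∑ a ∈ t i ∩ s.biUnion t, f a := sum_nonneg fun a _ => hf a
    linarith

theorem descend_root {V : Type*} [Fintype V] {r : V} {g : V → V} (hg : IsForest {r} g) :
    descend g r = univ := by
  ext x
  obtain ⟨ρ, hρ, h⟩ := hg.2 x
  rw [mem_singleton] at hρ
  simp [mem_descend, hρ ▸ h]

variable {V : Type*} [DecidableEq V] [Fintype V]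

/-- The number of non-root vertices whose parent is a root or lies on the path from `u` to its
root. -/
noncomputable def spread (R : Finset V) (g : V → V) (u : V) : ℕ :=
  #{v ∈ Rᶜ | g v ∈ R ∨ Below g u (g v)}

theorem spread_attach_le {R : Finset V} {g : V → V} {v x u : V} (hv : v ∉ R)
    (hx : x ∈ R) (hg : IsForest (insert v R) g) (hu : Below g u v) :
    spread R (Function.update g v x) u ≤ spread (insert v R) g u + 1 := by
  have hgx : g x = x := hg.1 x (by simp [hx])
  have hvx : x ≠ v := by rintro rfl; exact hv hx
  refine le_trans (card_le_card ?_) (card_insert_le v _)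
  intro w hw
  simp only [mem_filter, mem_insert, mem_compl] at hw ⊢
  by_cases hwv : w = v
  · exact Or.inl hwv
  right
  rw [Function.update_of_ne hwv] at hw
  refine ⟨by simp [hwv, hw.1], ?_⟩
  rcases hw.2 with h | h
  · exact Or.inl (Or.inr h)
  · rcases h.transfer (g' := g) (v := v) (fun y hy => by rw [Function.update_of_ne hy])
      with h | ⟨-, h⟩
    · exact Or.inr h
    · left
      rcases h.cases_step with h | h
      · exact Or.inl h.symm
      · rw [Function.update_self] at h
        right
        rwa [h.eq_of_fixed (by rw [Function.update_of_ne hvx, hgx])]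

theorem sum_path_le {z : ℝ} (hz : 1 ≤ z) {R : Finset V} {x : V} (hx : x ∈ R) :
    ∑ g ∈ forests R, ∑ u ∈ descend g x, z ^ spread R g u ≤
      ∑ g ∈ forests R, z ^ spread R g x +
        ∑ v ∈ Rᶜ, z * ∑ g ∈ forests (insert v R), ∑ u ∈ descend g v, z ^ spread (insert v R) g u := by
  have hz0 : 0 ≤ z := by linarith
  have h1 : ∀ g ∈ forests R, ∑ u ∈ descend g x, z ^ spread R g u ≤
      z ^ spread R g x + ∑ v ∈ Rᶜ, if g v = x then ∑ u ∈ descend g v, z ^ spread R g u else 0 := by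
    intro g hg
    rw [mem_forests] at hg
    have hsub : descend g x ⊆ insert x ((Rᶜ.filter (fun v => g v = x)).biUnion (descend g)) := by
      intro u hu
      rw [mem_descend] at hu
      rcases hu.cases_last with h | ⟨w, hw, hgw, huw⟩
      · simp [h]
      · have : w ∉ R := by
          intro h
          exact hw (by rw [← hgw, hg.1 w h])
        simp only [mem_insert, mem_biUnion, mem_filter, mem_compl, mem_descend]
        exact Or.inr ⟨w, ⟨this, hgw⟩, huw⟩
    calc ∑ u ∈ descend g x, z ^ spread R g u
        ≤ ∑ u ∈ insert x ((Rᶜ.filter (fun v => g v = x)).biUnion (descend g)),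
            z ^ spread R g u := sum_le_sum_of_subset_of_nonneg hsub (fun _ _ _ => by positivity)
      _ ≤ z ^ spread R g x + ∑ u ∈ (Rᶜ.filter (fun v => g v = x)).biUnion (descend g),
            z ^ spread R g u := by
          by_cases hmem : x ∈ (Rᶜ.filter (fun v => g v = x)).biUnion (descend g)
          · rw [insert_eq_of_mem hmem]
            have : 0 ≤ z ^ spread R g x := by positivity
            linarith
          · rw [sum_insert hmem]
      _ ≤ z ^ spread R g x + ∑ v ∈ Rᶜ.filter (fun v => g v = x), ∑ u ∈ descend g v,
            z ^ spread R g u := by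
          gcongr
          exact sum_biUnion_le_of_nonneg (fun _ => by positivity) _ _
      _ = _ := by rw [sum_filter]
  refine (sum_le_sum h1).trans ?_
  rw [sum_add_distrib, sum_comm]
  gcongr with v hv
  have hvR : v ∉ R := by simpa using hv
  rw [sum_forests_eq_sum_attach hvR, mul_sum]
  refine sum_le_sum fun g hg => ?_
  rw [mem_forests] at hg
  calc ∑ y ∈ (descend g v)ᶜ, (if Function.update g v y v = x then
          ∑ u ∈ descend (Function.update g v y) v, z ^ spread R (Function.update g v y) u else 0)
      ≤ ∑ u ∈ descend (Function.update g v x) v, z ^ spread R (Function.update g v x) u := by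
        simp only [Function.update_self]
        rw [← sum_filter]
        refine (sum_le_sum_of_subset_of_nonneg (t := {x}) ?_ (fun _ _ _ => by positivity)).trans ?_
        · intro y; simp
        · simp
    _ ≤ ∑ u ∈ descend g v, z ^ (spread (insert v R) g u + 1) := by
        have hsub : descend (Function.update g v x) v ⊆ descend g v := by
          intro u hu
          rw [mem_descend] at hu ⊢
          rcases hu.transfer (g' := g) (v := v) (fun y hy => by rw [Function.update_of_ne hy])
            with h | ⟨h, -⟩ <;> exact h
        refine (sum_le_sum_of_subset_of_nonneg hsub (fun _ _ _ => by positivity)).trans ?_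
        refine sum_le_sum fun u hu => ?_
        rw [mem_descend] at hu
        exact pow_le_pow_right₀ hz (spread_attach_le hvR hx hg hu)
    _ = z * ∑ u ∈ descend g v, z ^ spread (insert v R) g u := by
        rw [mul_sum]
        exact sum_congr rfl fun _ _ => by ring

theorem sum_root_spread_le {z : ℝ} (hz : 1 ≤ z) {R : Finset V} {x : V} (hx : x ∈ R) :
    ∑ g ∈ forests R, z ^ spread R g x ≤ (Fintype.card V : ℝ) ^ #Rᶜ *
      (#R * z / Fintype.card V * Real.exp (#R * (z - 1))) := by
  set n : ℝ := ((Fintype.card V : ℕ) : ℝ) with hn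
  have hn0 : 0 < n := by
    rw [hn, Nat.cast_pos]; exact Fintype.card_pos_iff.2 ⟨x⟩
  let ζ : V → ℝ := fun y => if y ∈ R then z else 1
  have h1 : ∀ g ∈ forests R, z ^ spread R g x = ∏ v ∈ Rᶜ, ζ (g v) := by
    intro g hg
    rw [mem_forests] at hg
    have : spread R g x = #(Rᶜ.filter (fun v => g v ∈ R)) := by
      unfold spread
      congr 1
      apply filter_congr
      intro v hv
      refine ⟨?_, Or.inl⟩
      rintro (h | h)
      · exact h
      · rw [h.eq_of_fixed (hg.1 x hx)]; exact hx
    rw [this, prod_ite, prod_const, prod_const_one, mul_one]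
  rw [sum_congr rfl h1]
  have h2 := sum_forests ζ R
  have hR : ∑ ρ ∈ R, ζ ρ = #R * z := by
    rw [sum_congr (g := fun _ => z) rfl (fun ρ hρ => by simp only [ζ, if_pos hρ]), sum_const,
      nsmul_eq_mul]
  have hs : ∑ y, ζ y = n + #R * (z - 1) := by
    have : ∀ y, ζ y = 1 + if y ∈ R then (z - 1) else 0 := by
      intro y; simp only [ζ]; split_ifs <;> ring
    rw [sum_congr rfl (fun y _ => this y), sum_add_distrib, ← sum_filter]
    simp [hn]
    ring
  rw [hR, hs] at h2
  set s := n + #R * (z - 1) with hsdef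
  have hj : 0 ≤ (#R : ℝ) * (z - 1) := mul_nonneg (by positivity) (by linarith)
  have hns : n ≤ s := by rw [hsdef]; linarith
  have hs0 : 0 < s := by linarith
  set F := ∑ g ∈ forests R, ∏ v ∈ Rᶜ, ζ (g v)
  have hF : F = #R * z * s ^ #Rᶜ / s := by field_simp; exact h2
  have hpow : s ^ #Rᶜ ≤ n ^ #Rᶜ * Real.exp (#R * (z - 1)) := by
    have : s = n * (1 + #R * (z - 1) / n) := by rw [hsdef]; field_simp
    rw [this, mul_pow]
    gcongr
    calc (1 + #R * (z - 1) / n) ^ #Rᶜ ≤ (Real.exp (#R * (z - 1) / n)) ^ #Rᶜ := by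
          gcongr
          rw [add_comm]; exact Real.add_one_le_exp _
      _ = Real.exp (#Rᶜ * (#R * (z - 1) / n)) := by rw [← Real.exp_nat_mul]
      _ ≤ _ := by
          apply Real.exp_le_exp.2
          have : (#Rᶜ : ℝ) ≤ n := by rw [hn]; exact_mod_cast card_le_univ _
          calc (#Rᶜ : ℝ) * (#R * (z - 1) / n) ≤ n * (#R * (z - 1) / n) := by gcongr
            _ = _ := by field_simp
  rw [hF]
  calc (#R : ℝ) * z * s ^ #Rᶜ / s ≤ #R * z * s ^ #Rᶜ / n := by gcongr
    _ ≤ #R * z * (n ^ #Rᶜ * Real.exp (#R * (z - 1))) / n := by gcongr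
    _ = _ := by ring

/-- The bound for the generating function of `spread` obtained by exploring the path to a
uniform vertex. -/
theorem sum_path_le_series {z : ℝ} (hz : 1 ≤ z) {R : Finset V} {x : V} (hx : x ∈ R)
    {n : ℕ} (hn : n = Fintype.card V) (P : ℕ → ℝ)
    (hP : ∀ j, P j = Real.exp (-((j : ℝ) * (j - 1)) / (2 * n)) * z ^ j) :
    P #R * ∑ g ∈ forests R, ∑ u ∈ descend g x, z ^ spread R g u ≤
      (n : ℝ) ^ #Rᶜ * ∑ i ∈ Icc #R n, P i * (i * z / n * Real.exp (i * (z - 1))) := by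
  have hn0 : 0 < (n : ℝ) := by
    rw [hn, Nat.cast_pos]; exact Fintype.card_pos_iff.2 ⟨x⟩
  have hz0 : 0 < z := by linarith
  have hP0 : ∀ j, 0 < P j := fun j => by rw [hP]; positivity
  induction hk : #Rᶜ generalizing R x with
  | zero =>
    have hj : #R = n := by rw [hn]; have := card_compl_add_card R; omega
    have hR : Rᶜ = ∅ := by simpa using hk
    have h := sum_path_le hz hx
    rw [hR, sum_empty, add_zero] at h
    have h' := sum_root_spread_le hz hx
    rw [hk, pow_zero, one_mul, ← hn] at h'
    rw [hj, Icc_self, sum_singleton, pow_zero, one_mul]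
    rw [hj] at h'
    exact mul_le_mul_of_nonneg_left (h.trans h') (hP0 _).le
  | succ k ih =>
    have hj : #R + (k + 1) = n := by rw [hn]; have := card_compl_add_card R; omega
    have h := sum_path_le hz hx
    have h' := sum_root_spread_le hz hx
    rw [hk, ← hn] at h'
    set j := #R with hjdef
    set Sig := ∑ i ∈ Icc (j + 1) n, P i * (i * z / n * Real.exp (i * (z - 1))) with hSig
    have hSig0 : 0 ≤ Sig := sum_nonneg fun i _ => mul_nonneg (hP0 i).le (by positivity)
    have hB : ∀ v ∈ Rᶜ, z * ∑ g ∈ forests (insert v R), ∑ u ∈ descend g v,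
        z ^ spread (insert v R) g u ≤ z * ((n : ℝ) ^ k * Sig / P (j + 1)) := by
      intro v hv
      have hvR : v ∉ R := by simpa using hv
      have hc : #(insert v R) = j + 1 := card_insert_of_notMem hvR
      have hc' : #(insert v R)ᶜ = k := by
        have := card_compl_add_card (insert v R)
        omega
      have := ih (R := insert v R) (x := v) (by simp) hc'
      rw [hc] at this
      gcongr
      rw [le_div_iff₀ (hP0 _), mul_comm]
      exact this
    have hsum := sum_le_sum hB
    rw [sum_const, hk, nsmul_eq_mul] at hsum
    have hratio : P j * z * ((k + 1 : ℕ) : ℝ) ≤ n * P (j + 1) := by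
      have hkk : ((k + 1 : ℕ) : ℝ) = n * (1 - j / n) := by
        rw [← hj]; push_cast
        have : (j : ℝ) + (k + 1) ≠ 0 := by positivity
        field_simp; ring
      have he : P (j + 1) = P j * z * Real.exp (-(j / n : ℝ)) := by
        rw [hP, hP]
        have : -(((j + 1 : ℕ) : ℝ) * (((j + 1 : ℕ) : ℝ) - 1)) / (2 * n)
            = -((j : ℝ) * (j - 1)) / (2 * n) + -(j / n : ℝ) := by
          push_cast; field_simp; ring
        rw [this, Real.exp_add, pow_succ]
        ring
      rw [hkk, he]
      have := Real.add_one_le_exp (-(j / n : ℝ))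
      have hpos : 0 < P j * z * n := by have := hP0 j; positivity
      nlinarith
    have hIcc : Icc j n = insert j (Icc (j + 1) n) := by
      ext i; simp only [mem_Icc, mem_insert]; omega
    rw [hIcc, sum_insert (by simp), ← hSig]
    have hPj := hP0 j
    have hPj1 := hP0 (j + 1)
    calc P j * ∑ g ∈ forests R, ∑ u ∈ descend g x, z ^ spread R g u
        ≤ P j * ((n : ℝ) ^ (k + 1) * (j * z / n * Real.exp (j * (z - 1))) +
          ((k + 1 : ℕ) : ℝ) * (z * ((n : ℝ) ^ k * Sig / P (j + 1)))) := by
          gcongr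
          exact h.trans (add_le_add h' hsum)
      _ = (n : ℝ) ^ (k + 1) * (P j * (j * z / n * Real.exp (j * (z - 1)))) +
          (P j * z * ((k + 1 : ℕ) : ℝ)) * ((n : ℝ) ^ k * Sig / P (j + 1)) := by ring
      _ ≤ (n : ℝ) ^ (k + 1) * (P j * (j * z / n * Real.exp (j * (z - 1)))) +
          (n * P (j + 1)) * ((n : ℝ) ^ k * Sig / P (j + 1)) := by gcongr
      _ = _ := by rw [pow_succ]; field_simp

theorem series_term_le {lam : ℝ} (hlam : 0 ≤ lam) {n : ℕ} (hn : 0 < n) (i : ℕ) :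
    Real.exp (-((i : ℝ) * (i - 1)) / (2 * n)) * (1 + lam / √n) ^ i *
      (i * (1 + lam / √n) / n * Real.exp (i * ((1 + lam / √n) - 1))) ≤
    Real.exp ((2 * lam + 2) ^ 2 / 2 + lam) / n * (i * (Real.exp (-(1 / √n))) ^ i) := by
  have hn1 : (1 : ℝ) ≤ n := by exact_mod_cast hn
  have hs : 1 ≤ √(n : ℝ) := Real.one_le_sqrt.2 hn1
  set w : ℝ := 1 / √(n : ℝ) with hw
  have hw0 : 0 < w := by positivity
  have hw1 : w ≤ 1 := by rw [hw, div_le_one (by linarith)]; exact hs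
  have hww : (1 : ℝ) / n = w ^ 2 := by rw [hw, div_pow, one_pow, Real.sq_sqrt (by linarith)]
  have hz : 1 + lam / √n ≤ Real.exp (lam * w) := by
    rw [add_comm, hw, mul_one_div]; exact Real.add_one_le_exp _
  have hz0 : 0 ≤ 1 + lam / √n := by positivity
  have e1 : -((i : ℝ) * (i - 1)) / (2 * n) = -((i * w) * (i * w - w)) / 2 := by
    have : -((i : ℝ) * (i - 1)) / (2 * n) = -((i : ℝ) * (i - 1)) / 2 * (1 / n) := by ring
    rw [this, hww]; ring
  have e2 : (i : ℝ) * ((1 + lam / √n) - 1) = lam * (i * w) := by rw [hw]; ring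
  rw [e1, e2]
  calc Real.exp (-((i * w) * (i * w - w)) / 2) * (1 + lam / √n) ^ i *
        (i * (1 + lam / √n) / n * Real.exp (lam * (i * w)))
      ≤ Real.exp (-((i * w) * (i * w - w)) / 2) * (Real.exp (lam * w)) ^ i *
        (i * Real.exp (lam * w) / n * Real.exp (lam * (i * w))) := by gcongr
    _ = Real.exp (-((i * w) * (i * w - w)) / 2 + i * (lam * w) + lam * w + lam * (i * w)) / n
          * i := by
        rw [← Real.exp_nat_mul, Real.exp_add, Real.exp_add, Real.exp_add]; ring
    _ ≤ Real.exp ((2 * lam + 2) ^ 2 / 2 + lam + i * (-w)) / n * i := by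
        refine mul_le_mul_of_nonneg_right (div_le_div_of_nonneg_right (Real.exp_le_exp.2 ?_)
          (by positivity)) (by positivity)
        have hx : 0 ≤ (i : ℝ) * w := by positivity
        nlinarith [sq_nonneg ((i : ℝ) * w - (2 * lam + 2)), mul_nonneg hx (sub_nonneg.2 hw1)]
    _ = _ := by
        rw [← Real.exp_nat_mul, Real.exp_add]; ring

theorem sum_mul_geometric_le {n : ℕ} (hn : 0 < n) (s : Finset ℕ) :
    ∑ i ∈ s, (i : ℝ) * (Real.exp (-(1 / √n))) ^ i ≤ 4 * n := by
  have hn1 : (1 : ℝ) ≤ n := by exact_mod_cast hn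
  have hs : 1 ≤ √(n : ℝ) := Real.one_le_sqrt.2 hn1
  set w : ℝ := 1 / √(n : ℝ) with hw
  have hw0 : 0 < w := by positivity
  have hw1 : w ≤ 1 := by rw [hw, div_le_one (by linarith)]; exact hs
  have hww : (1 : ℝ) / n = w ^ 2 := by rw [hw, div_pow, one_pow, Real.sq_sqrt (by linarith)]
  set r := Real.exp (-w) with hr
  have hr0 : 0 < r := Real.exp_pos _
  have hr1 : w / 2 ≤ 1 - r := by
    have h1 : r * Real.exp w = 1 := by rw [hr, ← Real.exp_add]; simp
    have h2 := Real.add_one_le_exp w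
    have h3 : r * (w + 1) ≤ 1 := (mul_le_mul_of_nonneg_left h2 hr0.le).trans_eq h1
    nlinarith
  have hlt : r < 1 := by linarith
  have hnorm : ‖r‖ < 1 := by rw [Real.norm_of_nonneg hr0.le]; exact hlt
  have hsum := hasSum_coe_mul_geometric_of_norm_lt_one hnorm
  refine (hsum.summable.sum_le_tsum s (fun i _ => by positivity)).trans ?_
  rw [hsum.tsum_eq, div_le_iff₀ (by have : 0 < 1 - r := by linarith
                                    positivity)]
  have h4 : (w / 2) ^ 2 ≤ (1 - r) ^ 2 := by gcongr
  have h5 : (n : ℝ) * w ^ 2 = 1 := by rw [← hww]; field_simp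
  nlinarith

/-- Uniform exponential moment bound for the number of vertices attached to the path from the
root to a uniform vertex of a uniform labelled tree. -/
theorem exists_spread_bound (lam : ℝ) (hlam : 0 ≤ lam) : ∃ C : ℝ, 0 < C ∧
    ∀ (V : Type) [DecidableEq V] [Fintype V] (r : V),
      ∑ g ∈ forests {r}, ∑ u, (1 + lam / √(Fintype.card V)) ^ spread {r} g u ≤
        C * (Fintype.card V : ℝ) ^ Fintype.card V / Fintype.card V := by
  refine ⟨4 * Real.exp ((2 * lam + 2) ^ 2 / 2 + lam), by positivity, ?_⟩
  intro V _ _ r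
  set n := Fintype.card V with hn
  have hn0 : 0 < n := Fintype.card_pos_iff.2 ⟨r⟩
  have hn1 : (0 : ℝ) < n := by exact_mod_cast hn0
  set z : ℝ := 1 + lam / √n with hz
  have hz1 : 1 ≤ z := by rw [hz]; have : 0 ≤ lam / √n := by positivity
                         linarith
  have h := sum_path_le_series hz1 (mem_singleton_self r) hn
    (fun j => Real.exp (-((j : ℝ) * (j - 1)) / (2 * n)) * z ^ j) (fun _ => rfl)
  have hcard : #({r}ᶜ : Finset V) = n - 1 := by rw [card_compl, card_singleton]
  have hdesc : ∑ g ∈ forests {r}, ∑ u ∈ descend g r, z ^ spread {r} g u =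
      ∑ g ∈ forests {r}, ∑ u, z ^ spread {r} g u := by
    refine sum_congr rfl fun g hg => ?_
    rw [descend_root (mem_forests.1 hg)]
  rw [hdesc, card_singleton, hcard] at h
  have hP1 : Real.exp (-(((1 : ℕ) : ℝ) * (((1 : ℕ) : ℝ) - 1)) / (2 * n)) * z ^ 1 = z := by simp
  rw [hP1] at h
  set Θ := ∑ g ∈ forests {r}, ∑ u, z ^ spread {r} g u
  have hΘ : 0 ≤ Θ := sum_nonneg fun _ _ => sum_nonneg fun _ _ => by positivity
  have hpow : (n : ℝ) ^ (n - 1) = (n : ℝ) ^ n / n := by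
    rw [eq_div_iff hn1.ne', ← pow_succ]; congr 1; omega
  calc Θ ≤ z * Θ := le_mul_of_one_le_left hΘ hz1
    _ ≤ _ := h
    _ ≤ (n : ℝ) ^ (n - 1) * ∑ i ∈ Icc 1 n, Real.exp ((2 * lam + 2) ^ 2 / 2 + lam) / n *
          (i * (Real.exp (-(1 / √n))) ^ i) := by
        refine mul_le_mul_of_nonneg_left (sum_le_sum fun i _ => ?_) (by positivity)
        exact series_term_le hlam hn0 i
    _ ≤ (n : ℝ) ^ (n - 1) * (Real.exp ((2 * lam + 2) ^ 2 / 2 + lam) / n * (4 * n)) := by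
        rw [← mul_sum]
        gcongr
        exact sum_mul_geometric_le hn0 _
    _ = _ := by rw [hpow]; field_simp

end Paths
end RandomTree

namespace RandomTree

section DepthFirst

variable {m : ℕ} {par : Fin m → Fin m} {r : Fin m}

theorem isForest_singleton_iff : IsForest {r} par ↔ IsPTree par r := by
  simp [IsForest, IsPTree, Below]

/-- The invariant of the depth-first exploration of a tree. -/
structure ExplorationInv (par : Fin m → Fin m) (r : Fin m) (s : St m) : Prop where
  nodup : (s.visited ++ s.stack).Nodup
  root : r ∈ s.visited ∨ r ∈ s.stack
  child : ∀ x, x ≠ r → par x ∈ s.visited → x ∈ s.visited ∨ x ∈ s.stack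
  parent : ∀ x, x ≠ r → x ∈ s.visited ∨ x ∈ s.stack → par x ∈ s.visited
  order : s.stack.Pairwise (fun a b => b ≠ r ∧ Below par a (par b) ∧ ¬ Below par a b)

theorem ExplorationInv.mem_visited_of_stack_eq_nil (ht : IsForest {r} par) {s : St m}
    (hs : ExplorationInv par r s) (h : s.stack = []) (x : Fin m) : x ∈ s.visited := by
  obtain ⟨ρ, hρ, k, hk⟩ := ht.2 x
  rw [mem_singleton] at hρ
  subst hρ
  have hroot : ρ ∈ s.visited := by simpa [h] using hs.root
  induction k generalizing x with
  | zero => rw [Function.iterate_zero_apply] at hk; exact hk ▸ hroot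
  | succ k ih =>
    rw [Function.iterate_succ_apply] at hk
    by_cases hx : x = ρ
    · exact hx ▸ hroot
    · simpa [h] using hs.child x hx (ih _ hk)

theorem ExplorationInv.explore (ht : IsForest {r} par) {s : St m}
    (hs : ExplorationInv par r s) {v : Fin m} {rest ns : List (Fin m)} (h : s.stack = v :: rest)
    (hnd : ns.Nodup) (hns : ∀ w, w ∈ ns ↔ w ≠ r ∧ par w = v ∧ w ∉ s.stack ∧ w ∉ s.visited) :
    ExplorationInv par r ⟨ns ++ rest, s.visited ++ [v]⟩ := by
  obtain ⟨h1, h2, h3, h4, h5⟩ := hs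
  have hr : par r = r := ht.1 r (by simp)
  have hbr : ∀ x, Below par x r := fun x => by simpa using ht.2 x
  rw [h] at h1 h5
  rw [List.pairwise_cons] at h5
  rw [h] at hns h2 h3 h4
  have h1' := h1
  simp only [List.nodup_append, List.nodup_cons, List.mem_cons] at h1'
  obtain ⟨hv, ⟨hvr, hrest⟩, hdisj⟩ := h1'
  simp only [List.mem_cons] at h2 h3 h4 hns
  constructor
  · simp only [List.nodup_append, List.mem_append, List.mem_singleton, List.nodup_singleton]
    refine ⟨⟨hv, trivial, ?_⟩, ⟨hnd, hrest, ?_⟩, ?_⟩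
    · rintro a ha b rfl
      exact hdisj a ha b (Or.inl rfl)
    · rintro a ha b hb rfl
      exact ((hns a).1 ha).2.2.1 (Or.inr hb)
    · rintro a (ha | ha) b (hb | hb) rfl
      · exact ((hns a).1 hb).2.2.2 ha
      · exact hdisj a ha a (Or.inr hb) rfl
      · exact ((hns a).1 hb).2.2.1 (Or.inl ha)
      · exact hvr (ha ▸ hb)
  · simp only [List.mem_append, List.mem_singleton]
    tauto
  · intro x hx hp
    simp only [List.mem_append, List.mem_singleton] at hp ⊢
    rw [hns]
    have := h3 x hx
    tauto
  · intro x hx hp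
    simp only [List.mem_append, List.mem_singleton] at hp ⊢
    rw [hns] at hp
    have := h4 x hx
    tauto
  · simp only [List.pairwise_append]
    refine ⟨?_, h5.2, ?_⟩
    · refine List.Nodup.pairwise_of_forall_ne hnd fun a ha b hb hab => ?_
      obtain ⟨ha1, ha2, -⟩ := (hns a).1 ha
      obtain ⟨hb1, hb2, -⟩ := (hns b).1 hb
      refine ⟨hb1, hb2 ▸ ha2 ▸ Below.step par a, fun hc => hb1 ?_⟩
      rcases hc.cases_step with hc | hc
      · exact absurd hc hab
      · rw [ha2, ← hb2] at hc
        exact Below.eq_of_cycle hr (hbr b) hc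
    · intro a ha b hb
      obtain ⟨ha1, ha2, ha3, -⟩ := (hns a).1 ha
      obtain ⟨hb1, hb2, hb3⟩ := h5.1 b hb
      refine ⟨hb1, (ha2 ▸ Below.step par a).trans hb2, fun hc => ?_⟩
      rcases hc.cases_step with hc | hc
      · exact ha3 (Or.inr (hc ▸ hb))
      · exact hb3 (ha2 ▸ hc)

theorem step_of_stack_eq_cons (ht : IsForest {r} par) {s : St m} (hs : ExplorationInv par r s)
    {v : Fin m} {rest : List (Fin m)} (h : s.stack = v :: rest) :
    ExplorationInv par r (step (childAdj par r) s) ∧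
      (step (childAdj par r) s).visited = s.visited ++ [v] := by
  set ns := (List.finRange m).filter
      (fun w => childAdj par r v w && !(decide (w ∈ s.stack)) && !(decide (w ∈ s.visited))) with hns
  have hnd : ns.Nodup := (List.nodup_finRange m).filter _
  have hmem : ∀ w, w ∈ ns ↔ w ≠ r ∧ par w = v ∧ w ∉ s.stack ∧ w ∉ s.visited := by
    intro w
    simp [hns, childAdj, and_assoc]
  have key := hs.explore ht h hnd hmem
  have hstep : step (childAdj par r) s = ⟨ns ++ rest, s.visited ++ [v]⟩ := by
    unfold step
    split
    · simp_all
    · rename_i v' rest' heq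
      rw [h, List.cons.injEq] at heq
      obtain ⟨rfl, rfl⟩ := heq
      simp only [← hns]
      split_ifs with he
      · rw [List.isEmpty_iff] at he
        have hall := key.mem_visited_of_stack_eq_nil ht he
        rw [he, List.filter_eq_nil_iff.2]
        · rfl
        · intro a _
          have := hall a
          simp only [List.mem_append, List.mem_singleton] at this
          simpa [Classical.or_iff_not_imp_left] using this
      · rfl
  rw [hstep]
  exact ⟨key, rfl⟩

theorem explorationInv_step (ht : IsForest {r} par) {s : St m} (hs : ExplorationInv par r s) :
    ExplorationInv par r (step (childAdj par r) s) := by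
  cases h : s.stack with
  | nil => rw [show step (childAdj par r) s = s by unfold step; rw [h]]; exact hs
  | cons v rest => exact (step_of_stack_eq_cons ht hs h).1

theorem stateAt_succ (adj : Fin m → Fin m → Bool) (i : ℕ) :
    stateAt adj r (i + 1) = step adj (stateAt adj r i) :=
  Function.iterate_succ_apply' _ _ _

theorem explorationInv_stateAt (ht : IsForest {r} par) (i : ℕ) :
    ExplorationInv par r (stateAt (childAdj par r) r i) := by
  induction i with
  | zero =>
    refine ⟨by simp [stateAt], by simp [stateAt], by simp [stateAt], by simp [stateAt],
      by simp [stateAt]⟩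
  | succ i ih => rw [stateAt_succ]; exact explorationInv_step ht ih

theorem exists_stack_eq_cons (ht : IsForest {r} par) {i : ℕ} (hi : i < m)
    (hl : (stateAt (childAdj par r) r i).visited.length = i) :
    ∃ v rest, (stateAt (childAdj par r) r i).stack = v :: rest := by
  have hinv := explorationInv_stateAt ht i
  cases h : (stateAt (childAdj par r) r i).stack with
  | nil =>
    exfalso
    have hall := hinv.mem_visited_of_stack_eq_nil ht h
    have hnd := hinv.nodup
    rw [h, List.append_nil] at hnd
    have h1 := List.toFinset_card_of_nodup hnd
    rw [show (stateAt (childAdj par r) r i).visited.toFinset = univ by ext x; simp [hall],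
      hl, card_univ, Fintype.card_fin] at h1
    omega
  | cons v rest => exact ⟨v, rest, rfl⟩

theorem length_visited (ht : IsForest {r} par) {i : ℕ} (hi : i ≤ m) :
    (stateAt (childAdj par r) r i).visited.length = i := by
  induction i with
  | zero => simp [stateAt]
  | succ i ih =>
    obtain ⟨v, rest, h⟩ := exists_stack_eq_cons ht hi (ih (by omega))
    rw [stateAt_succ, (step_of_stack_eq_cons ht (explorationInv_stateAt ht i) h).2,
      List.length_append, ih (by omega), List.length_singleton]

theorem visited_prefix (ht : IsForest {r} par) (i k : ℕ) :
    (stateAt (childAdj par r) r i).visited <+: (stateAt (childAdj par r) r (i + k)).visited := by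
  induction k with
  | zero => exact List.prefix_refl _
  | succ k ih =>
    refine ih.trans ?_
    rw [← add_assoc, stateAt_succ]
    cases h : (stateAt (childAdj par r) r (i + k)).stack with
    | nil =>
      rw [show step (childAdj par r) (stateAt (childAdj par r) r (i + k)) =
        stateAt (childAdj par r) r (i + k) by unfold step; rw [h]]
    | cons v rest =>
      rw [(step_of_stack_eq_cons ht (explorationInv_stateAt ht _) h).2]
      exact List.prefix_append _ _

theorem mem_visited_iff (ht : IsForest {r} par) {i : ℕ} (hi : i ≤ m) (x : Fin m) :
    x ∈ (stateAt (childAdj par r) r i).visited ↔ dfsPos par r x < i := by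
  have h1 : (stateAt (childAdj par r) r i).visited = (dfsOrder par r).take i := by
    have := visited_prefix ht i (m - i)
    rw [Nat.add_sub_cancel' hi, List.prefix_iff_eq_take, length_visited ht hi] at this
    exact this
  have hl : (dfsOrder par r).length = m := length_visited ht le_rfl
  have h2 : x ∈ (dfsOrder par r).take i ↔
      ((dfsOrder par r).take i).findIdx (fun w => decide (w = x)) < ((dfsOrder par r).take i).length := by
    rw [List.findIdx_lt_length]
    simp
  rw [h1, h2, List.findIdx_take, List.length_take, hl]
  unfold dfsPos
  omega

theorem dfsPos_lt (ht : IsForest {r} par) (x : Fin m) : dfsPos par r x < m := by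
  rw [← mem_visited_iff ht le_rfl]
  have hinv := explorationInv_stateAt ht m
  have h1 := List.toFinset_card_of_nodup (List.nodup_append.1 hinv.nodup).1
  rw [length_visited ht le_rfl] at h1
  have h2 := (card_eq_iff_eq_univ _).1 (h1.trans (Fintype.card_fin m).symm)
  rw [← List.mem_toFinset, h2]
  exact mem_univ _

theorem exists_stack_dfsPos (ht : IsForest {r} par) (x : Fin m) :
    ∃ rest, (stateAt (childAdj par r) r (dfsPos par r x)).stack = x :: rest := by
  have hx := dfsPos_lt ht x
  obtain ⟨v, rest, h⟩ := exists_stack_eq_cons ht hx (length_visited ht hx.le)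
  have h1 : x ∈ (stateAt (childAdj par r) r (dfsPos par r x + 1)).visited :=
    (mem_visited_iff ht hx x).2 (Nat.lt_succ_self _)
  have h2 : x ∉ (stateAt (childAdj par r) r (dfsPos par r x)).visited := by
    rw [mem_visited_iff ht hx.le]; exact lt_irrefl _
  rw [stateAt_succ, (step_of_stack_eq_cons ht (explorationInv_stateAt ht _) h).2,
    List.mem_append, List.mem_singleton] at h1
  rcases h1 with h1 | rfl
  · exact absurd h1 h2
  · exact ⟨rest, h⟩

theorem dfsPos_root (ht : IsForest {r} par) : dfsPos par r r = 0 := by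
  have hm : 0 < m := r.pos
  have h : r ∈ (stateAt (childAdj par r) r 1).visited := by
    have h0 : (stateAt (childAdj par r) r 0).stack = [r] := rfl
    rw [stateAt_succ, (step_of_stack_eq_cons ht (explorationInv_stateAt ht 0) h0).2]
    simp
  rw [mem_visited_iff ht hm] at h
  omega

/-- A permitted edge leads to a vertex whose parent is an ancestor of its tail. -/
theorem below_of_mem_permitted (ht : IsForest {r} par) {u v : Fin m}
    (h : (u, v) ∈ permitted par r) : v ≠ r ∧ Below par u (par v) ∧ ¬ Below par u v := by
  simp only [permitted, mem_filter, mem_univ, true_and] at h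
  obtain ⟨huv, hlt, i, hi, hu, hv⟩ := h
  have hvr : v ≠ r := by
    rintro rfl
    rw [dfsPos_root ht] at hlt
    omega
  have hut := dfsPos_lt ht u
  have hinv := explorationInv_stateAt ht i
  have hiu : i ≤ dfsPos par r u := by
    by_contra hc
    rw [not_le, ← mem_visited_iff ht hi] at hc
    exact (List.nodup_append.1 hinv.nodup).2.2 u hc u hu rfl
  have hpv := hinv.parent v hvr (Or.inr hv)
  rw [mem_visited_iff ht hi] at hpv
  have hinv' := explorationInv_stateAt ht (dfsPos par r u)
  have hmem := hinv'.child v hvr ((mem_visited_iff ht hut.le _).2 (by omega))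
  rw [mem_visited_iff ht hut.le] at hmem
  obtain ⟨rest, hrest⟩ := exists_stack_dfsPos ht u
  have hpw := hinv'.order
  rw [hrest] at hmem hpw
  rw [List.pairwise_cons] at hpw
  refine hpw.1 v ?_
  rcases hmem with h | h
  · omega
  · rcases List.mem_cons.1 h with h | h
    · exact absurd h.symm huv
    · exact h

/-- The descendants of `y` form an interval of the planar order. -/
theorem below_of_dfsPos_le (ht : IsForest {r} par) {x x' y : Fin m} (h : Below par x' y)
    (h1 : dfsPos par r y < dfsPos par r x) (h2 : dfsPos par r x ≤ dfsPos par r x') :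
    Below par x y := by
  have hx := dfsPos_lt ht x
  have hinv := explorationInv_stateAt ht (dfsPos par r x)
  have hy : y ∈ (stateAt (childAdj par r) r (dfsPos par r x)).visited :=
    (mem_visited_iff ht hx.le y).2 h1
  have hx' : x' ∉ (stateAt (childAdj par r) r (dfsPos par r x)).visited := by
    rw [mem_visited_iff ht hx.le]; omega
  have hs : ∃ s ∈ (stateAt (childAdj par r) r (dfsPos par r x)).stack, Below par s y := by
    obtain ⟨k, hk⟩ := h
    clear h2
    induction k generalizing x' with
    | zero => rw [Function.iterate_zero_apply] at hk; exact absurd (hk ▸ hy) hx'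
    | succ k ih =>
      by_cases hp : par x' ∈ (stateAt (childAdj par r) r (dfsPos par r x)).visited
      · have hr : x' ≠ r := by
          rintro rfl
          rw [ht.1 x' (by simp)] at hp
          exact hx' hp
        exact ⟨x', (hinv.child x' hr hp).resolve_left hx', k + 1, hk⟩
      · exact ih hp (by rwa [Function.iterate_succ_apply] at hk)
  obtain ⟨s, hs, hsy⟩ := hs
  obtain ⟨rest, hrest⟩ := exists_stack_dfsPos ht x
  have hpw := hinv.order
  have hsy' : y ≠ s := (List.nodup_append.1 hinv.nodup).2.2 y hy s hs
  rw [hrest] at hs hpw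
  rw [List.pairwise_cons] at hpw
  rcases List.mem_cons.1 hs with rfl | hs
  · exact hsy
  · obtain ⟨-, h3, -⟩ := hpw.1 s hs
    rcases hsy.cases_step with h | h
    · exact absurd h.symm hsy'
    · exact h3.trans h

end DepthFirst
end RandomTree

namespace RandomTree

section Components

variable {m : ℕ} {par : Fin m → Fin m} {r : Fin m}

/-- The unmarked elements of `B` which may be marked. -/
noncomputable def markable (par : Fin m → Fin m) (B M : Finset (Fin m × Fin m)) :
    Finset (Fin m × Fin m) :=
  (B \ M).filter (fun x => Anc par x.2 x.1 ∨ ∃ y ∈ M, Anc par x.2 y.1)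

theorem markStep_eq_dite (B M : Finset (Fin m × Fin m)) :
    markStep par r B M = if h : (markable par B M).Nonempty then
      M ∪ (markable par B M).filter
        (fun x => lexKey par r x = ((markable par B M).image (lexKey par r)).min' (h.image _))
    else M := rfl

theorem markStep_subset {B M : Finset (Fin m × Fin m)} (h : M ⊆ B) : markStep par r B M ⊆ B := by
  rw [markStep_eq_dite]
  split_ifs
  · refine union_subset h ((filter_subset _ _).trans ((filter_subset _ _).trans sdiff_subset))
  · exact h

theorem markStep_eq_self {B M : Finset (Fin m × Fin m)} (h : markable par B M = ∅) :
    markStep par r B M = M := by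
  rw [markStep_eq_dite, dif_neg (not_nonempty_iff_eq_empty.2 h)]

theorem card_lt_card_markStep {B M : Finset (Fin m × Fin m)} (h : markable par B M ≠ ∅) :
    #M < #(markStep par r B M) := by
  have hne : (markable par B M).Nonempty := nonempty_iff_ne_empty.2 h
  obtain ⟨x, hx, hmin⟩ := mem_image.1 (((markable par B M).image (lexKey par r)).min'_mem (hne.image _))
  refine card_lt_card (ssubset_iff.2 ⟨x, ?_, ?_⟩)
  · simp only [markable, mem_filter, mem_sdiff] at hx
    exact hx.1.2
  · rw [markStep_eq_dite, dif_pos hne]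
    exact insert_subset (mem_union_right _ (mem_filter.2 ⟨hx, hmin⟩)) subset_union_left

theorem iterate_markStep_subset (B : Finset (Fin m × Fin m)) (k : ℕ) :
    (markStep par r B)^[k] ∅ ⊆ B := by
  induction k with
  | zero => simp
  | succ k ih => rw [Function.iterate_succ_apply']; exact markStep_subset ih

theorem markable_iterate_markStep (B : Finset (Fin m × Fin m)) :
    markable par B ((markStep par r B)^[#B] ∅) = ∅ := by
  have key : ∀ k, markable par B ((markStep par r B)^[k] ∅) = ∅ ∨
      k ≤ #((markStep par r B)^[k] ∅) := by
    intro k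
    induction k with
    | zero => exact Or.inr (Nat.zero_le _)
    | succ k ih =>
      rw [Function.iterate_succ_apply']
      by_cases h : markable par B ((markStep par r B)^[k] ∅) = ∅
      · rw [markStep_eq_self h]; exact Or.inl h
      · exact Or.inr ((ih.resolve_left h).trans_lt (card_lt_card_markStep h))
  rcases key #B with h | h
  · exact h
  · rw [eq_of_subset_of_card_le (iterate_markStep_subset B _) h]
    simp [markable]

theorem mem_markedEdges_of_back {b : Fin m → Fin m → Bool} {x y : Fin m}
    (h : (x, y) ∈ markedEdges par r b) : b x y = true := by
  have := iterate_markStep_subset _ _ h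
  simpa [backFinset] using this

theorem mem_markedEdges {b : Fin m → Fin m → Bool} {x y : Fin m} (hb : b x y = true)
    (h : Below par x y ∨ ∃ x' y', (x', y') ∈ markedEdges par r b ∧ Below par x' y) :
    (x, y) ∈ markedEdges par r b := by
  by_contra hc
  have h0 := markable_iterate_markStep (par := par) (r := r) (backFinset b)
  have : (x, y) ∈ markable par (backFinset b) ((markStep par r (backFinset b))^[#(backFinset b)] ∅) := by
    simp only [markable, mem_filter, mem_sdiff]
    refine ⟨⟨by simpa [backFinset] using hb, hc⟩, h.imp id ?_⟩
    rintro ⟨x', y', h1, h2⟩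
    exact ⟨(x', y'), h1, h2⟩
  rw [h0] at this
  simp at this

theorem edgeXstar.edgeX {b s : Fin m → Fin m → Bool} {a c : Fin m} (h : edgeXstar par r b a c) :
    edgeX par r b s a c :=
  h.imp id fun h => Or.inl (mem_markedEdges_of_back h)

theorem Below.reflTransGen {b s : Fin m → Fin m → Bool} (hr : par r = r) {x y : Fin m}
    (h : Below par x y) : Relation.ReflTransGen (edgeX par r b s) y x := by
  obtain ⟨k, hk⟩ := h
  induction k generalizing x with
  | zero => rw [Function.iterate_zero_apply] at hk; rw [hk]
  | succ k ih =>
    rw [Function.iterate_succ_apply] at hk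
    by_cases hx : x = r
    · subst hx; rw [hr] at hk; exact ih hk
    · exact (ih hk).tail (Or.inl ⟨hx, rfl⟩)

variable {b s : Fin m → Fin m → Bool}

theorem exists_first_back_edge
    (hs : ∀ u v, s u v = true → ¬ Relation.ReflTransGen (edgeX par r b s) v u) {y z : Fin m}
    (h : Relation.ReflTransGen (edgeX par r b s) y z)
    (h' : Relation.ReflTransGen (edgeX par r b s) z y) :
    Below par z y ∨ ∃ x' y', b x' y' = true ∧ Below par x' y ∧
      Relation.ReflTransGen (edgeX par r b s) y' z := by
  induction h with
  | refl => exact Or.inl (Below.refl _ _)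
  | tail hz he ih =>
    rcases ih (h'.head he) with h1 | ⟨x', y', h1, h2, h3⟩
    · rcases he with ⟨-, he⟩ | he | he
      · exact Or.inl ((he ▸ Below.step par _).trans h1)
      · exact Or.inr ⟨_, _, he, h1, .refl⟩
      · exact absurd (h'.trans hz) (hs _ _ he)
    · exact Or.inr ⟨x', y', h1, h2, h3.tail he⟩

theorem mem_markedEdges_of_cycle (ht : IsForest {r} par)
    (hb : ∀ u w, b u w = true → dfsPos par r w < dfsPos par r u)
    (hs : ∀ u v, s u v = true → ¬ Relation.ReflTransGen (edgeX par r b s) v u) {x y : Fin m}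
    (hxy : b x y = true) (h : Relation.ReflTransGen (edgeX par r b s) y x) :
    (x, y) ∈ markedEdges par r b := by
  have hr : par r = r := ht.1 r (by simp)
  induction hn : dfsPos par r x using Nat.strong_induction_on generalizing x y with
  | _ n ih =>
    subst hn
    apply mem_markedEdges hxy
    rcases exists_first_back_edge hs h (.single (Or.inr (Or.inl hxy)))
      with h1 | ⟨x', y', h1, h2, h3⟩
    · exact Or.inl h1
    · by_cases hlt : dfsPos par r x' < dfsPos par r x
      · refine Or.inr ⟨x', y', ih _ hlt h1 ?_ rfl, h2⟩
        exact (h3.tail (Or.inr (Or.inl hxy))).trans (h2.reflTransGen hr)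
      · exact Or.inl (below_of_dfsPos_le ht h2 (hb _ _ hxy) (not_lt.1 hlt))

/-- If no surplus edge lies on a cycle, then the surplus edges and the unmarked back edges do
not contribute to the strongly connected components. -/
theorem sameSCCs_of_forall_surplus (ht : IsForest {r} par)
    (hb : ∀ u w, b u w = true → dfsPos par r w < dfsPos par r u)
    (hs : ∀ u v, s u v = true → ¬ Relation.ReflTransGen (edgeX par r b s) v u) :
    SameSCCs (edgeX par r b s) (edgeXstar par r b) := by
  have hedge : ∀ a c, edgeX par r b s a c → Relation.ReflTransGen (edgeX par r b s) c a →
      edgeXstar par r b a c := by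
    rintro a c (h | h | h) hc
    · exact Or.inl h
    · exact Or.inr (mem_markedEdges_of_cycle ht hb hs h hc)
    · exact absurd hc (hs _ _ h)
  have hmono : ∀ a c, Relation.ReflTransGen (edgeXstar par r b) a c →
      Relation.ReflTransGen (edgeX par r b s) a c :=
    fun a c => Relation.ReflTransGen.mono (fun _ _ (h : edgeXstar par r b _ _) => h.edgeX) a c
  have hpath : ∀ a c, Relation.ReflTransGen (edgeX par r b s) a c →
      Relation.ReflTransGen (edgeX par r b s) c a →
      Relation.ReflTransGen (edgeXstar par r b) a c := by
    intro a c h h'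
    induction h with
    | refl => exact .refl
    | tail hz he ih => exact (ih (h'.head he)).tail (hedge _ _ he (h'.trans hz))
  have hiff : ∀ u v, SameSCC (edgeX par r b s) u v ↔ SameSCC (edgeXstar par r b) u v := fun u v =>
    ⟨fun h => ⟨hpath _ _ h.1 h.2, hpath _ _ h.2 h.1⟩, fun h => ⟨hmono _ _ h.1, hmono _ _ h.2⟩⟩
  refine ⟨hiff, fun u v => ⟨fun h => ⟨hedge _ _ h.1 h.2.2, (hiff u v).1 h.2⟩,
    fun h => ⟨h.1.edgeX, (hiff u v).2 h.2⟩⟩⟩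

/-- If the head of an edge `(u, v)` leads back to its tail outside the subtree of `v`, some back
edge or surplus edge leaves this subtree. -/
theorem exists_edge_leaving {u v : Fin m}
    (h : Relation.ReflTransGen (edgeX par r b s) v u) (huv : ¬ Below par u v) :
    ∃ x y, Below par x v ∧ ¬ Below par y v ∧ (b x y = true ∨ s x y = true) := by
  induction h with
  | refl => exact absurd (Below.refl _ _) huv
  | @tail x y _ he ih =>
    by_cases hx : Below par x v
    · rcases he with ⟨-, he⟩ | he
      · exact absurd ((he ▸ Below.step par y).trans hx) huv
      · exact ⟨x, y, hx, huv, he⟩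
    · exact ih hx

end Components
end RandomTree

namespace RandomTree

section Bernoulli

variable {α : Type*} [Fintype α]

/-- The weight of a configuration of edges, where the edges of `P` are present independently
with probability `p` and the other edges are absent. -/
noncomputable def bernW (p : ℝ) (P : Finset (α × α)) (s : α → α → Bool) : ℝ :=
  if ∀ u w, s u w = true → (u, w) ∈ P then ∏ x ∈ P, (if s x.1 x.2 then p else 1 - p) else 0

theorem bernW_nonneg {p : ℝ} (h0 : 0 ≤ p) (h1 : p ≤ 1) (P : Finset (α × α)) (s : α → α → Bool) :
    0 ≤ bernW p P s := by
  unfold bernW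
  split_ifs
  · refine prod_nonneg fun x _ => ?_
    split_ifs <;> linarith
  · exact le_rfl

variable [DecidableEq α]

theorem sum_bernW_mul_indicator (p : ℝ) (P A : Finset (α × α)) :
    ∑ s : α → α → Bool, bernW p P s * (if ∀ x ∈ A, s x.1 x.2 = true then 1 else 0) =
      if A ⊆ P then p ^ #A else 0 := by
  let F : α × α → Bool → ℝ := fun x c =>
    if c then (if x ∈ P then p else 0) else (if x ∈ A then 0 else if x ∈ P then 1 - p else 1)
  have h1 : ∀ s : α → α → Bool, bernW p P s * (if ∀ x ∈ A, s x.1 x.2 = true then 1 else 0) =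
      ∏ x, F x (s x.1 x.2) := by
    intro s
    by_cases hP : ∀ u w, s u w = true → (u, w) ∈ P
    · by_cases hA : ∀ x ∈ A, s x.1 x.2 = true
      · rw [bernW, if_pos hP, if_pos hA, mul_one, ← prod_subset (subset_univ P)]
        · refine prod_congr rfl fun x hx => ?_
          have := hA x
          by_cases hs : s x.1 x.2 <;> simp_all [F]
        · intro x _ hx
          have h1 := hP x.1 x.2
          have h2 := hA x
          by_cases hs : s x.1 x.2 <;> simp_all [F]
      · rw [if_neg hA, mul_zero]
        push Not at hA
        obtain ⟨x, hx, hs⟩ := hA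
        rw [prod_eq_zero (mem_univ x)]
        simp_all [F]
    · rw [bernW, if_neg hP, zero_mul]
      push Not at hP
      obtain ⟨u, w, hs, hx⟩ := hP
      rw [prod_eq_zero (mem_univ (u, w))]
      simp_all [F]
  rw [sum_congr rfl fun s _ => h1 s]
  rw [← (Equiv.curry α α Bool).sum_comp]
  have h2 := prod_univ_sum (fun _ : α × α => (univ : Finset Bool)) F
  rw [Fintype.piFinset_univ] at h2
  refine Eq.trans ?_ (h2.symm.trans ?_)
  · rfl
  · split_ifs with h
    · have h3 : ∀ x, ∑ c, F x c = if x ∈ A then p else 1 := by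
        intro x
        have := @h x
        by_cases hA : x ∈ A <;> by_cases hP : x ∈ P <;> simp_all [F]
      rw [prod_congr rfl fun x _ => h3 x, prod_ite_mem, univ_inter, prod_const]
    · rw [not_subset] at h
      obtain ⟨x, hx, hxP⟩ := h
      exact prod_eq_zero (mem_univ x) (by simp [F, hx, hxP])

theorem sum_bernW (p : ℝ) (P : Finset (α × α)) : ∑ s : α → α → Bool, bernW p P s = 1 := by
  simpa using sum_bernW_mul_indicator p P ∅

theorem sum_bernW_mul_indicator_le {p : ℝ} (h0 : 0 ≤ p) (P A : Finset (α × α)) :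
    ∑ s : α → α → Bool, bernW p P s * (if ∀ x ∈ A, s x.1 x.2 = true then 1 else 0) ≤ p ^ #A := by
  rw [sum_bernW_mul_indicator]
  split_ifs
  · exact le_rfl
  · positivity

theorem sum_bernW_mul_le_mul_left {p : ℝ} (h0 : 0 ≤ p) (h1 : p ≤ 1) (P Q : Finset (α × α))
    (x : α × α) (L : (α → α → Bool) → (α → α → Bool) → Prop) :
    ∑ b, ∑ s, bernW p Q b * bernW p P s * (if s x.1 x.2 = true ∧ L b s then 1 else 0) ≤ p := by
  calc ∑ b, ∑ s, bernW p Q b * bernW p P s * (if s x.1 x.2 = true ∧ L b s then 1 else 0)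
      ≤ ∑ b, ∑ s, bernW p Q b * (bernW p P s * (if s x.1 x.2 = true then 1 else 0)) := by
        refine sum_le_sum fun b _ => sum_le_sum fun s _ => ?_
        rw [mul_assoc]
        refine mul_le_mul_of_nonneg_left (mul_le_mul_of_nonneg_left ?_ (bernW_nonneg h0 h1 P s))
          (bernW_nonneg h0 h1 Q b)
        split_ifs with h2 h3 h3
        · exact le_rfl
        · exact absurd h2.1 h3
        · exact zero_le_one
        · exact le_rfl
    _ = ∑ s, bernW p P s * (if s x.1 x.2 = true then 1 else 0) := by
        rw [← sum_mul_sum, sum_bernW, one_mul]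
    _ ≤ p := by simpa using sum_bernW_mul_indicator_le h0 P {x}

theorem sum_bernW_mul_exists_le {p : ℝ} (h0 : 0 ≤ p) (h1 : p ≤ 1) (P Q : Finset (α × α))
    (x : α × α) (T : Finset α) (hx : x.1 ∉ T) (L : (α → α → Bool) → (α → α → Bool) → Prop)
    (hL : ∀ b s, L b s → ∃ w ∈ T, ∃ y, b w y = true ∨ s w y = true) :
    ∑ b, ∑ s, bernW p Q b * bernW p P s * (if s x.1 x.2 = true ∧ L b s then 1 else 0) ≤
      p * (2 * p * Fintype.card α * #T) := by
  let f : α → α → (α → α → Bool) → (α → α → Bool) → ℝ := fun w y b s =>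
    (bernW p Q b * (if b w y = true then 1 else 0)) *
      (bernW p P s * (if s x.1 x.2 = true then 1 else 0)) +
    bernW p Q b * (bernW p P s *
      (if ∀ e ∈ ({x, (w, y)} : Finset (α × α)), s e.1 e.2 = true then 1 else 0))
  have hpt : ∀ b s, bernW p Q b * bernW p P s *
      (if s x.1 x.2 = true ∧ L b s then 1 else 0) ≤ ∑ w ∈ T, ∑ y, f w y b s := by
    intro b s
    have hQ := bernW_nonneg h0 h1 Q b
    have hP := bernW_nonneg h0 h1 P s
    have hnn : ∀ w y, 0 ≤ f w y b s := by
      intro w y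
      simp only [f]
      split_ifs <;> positivity
    by_cases h : s x.1 x.2 = true ∧ L b s
    · rw [if_pos h]
      obtain ⟨w, hw, y, hwy⟩ := hL b s h.2
      refine le_trans ?_ (single_le_sum (fun w _ => sum_nonneg fun y _ => hnn w y) hw)
      refine le_trans ?_ (single_le_sum (fun y _ => hnn w y) (mem_univ y))
      simp only [f]
      rcases hwy with hwy | hwy
      · rw [if_pos hwy, if_pos h.1]
        refine le_add_of_le_of_nonneg (by simp) ?_
        split_ifs <;> positivity
      · rw [if_pos (show ∀ e ∈ ({x, (w, y)} : Finset (α × α)), s e.1 e.2 = true by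
          simp [h.1, hwy])]
        refine le_add_of_nonneg_of_le ?_ (by simp)
        split_ifs <;> positivity
    · rw [if_neg h, mul_zero]
      exact sum_nonneg fun w _ => sum_nonneg fun y _ => hnn w y
  have hf : ∀ w ∈ T, ∀ y, ∑ b, ∑ s, f w y b s ≤ p * p + p ^ 2 := by
    intro w hw y
    simp only [f, sum_add_distrib]
    rw [← sum_mul_sum, ← sum_mul_sum, sum_bernW, one_mul]
    refine add_le_add (mul_le_mul ?_ ?_ ?_ h0) ?_
    · simpa using sum_bernW_mul_indicator_le h0 Q {(w, y)}
    · simpa using sum_bernW_mul_indicator_le h0 P {x}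
    · refine sum_nonneg fun s _ => mul_nonneg (bernW_nonneg h0 h1 P s) ?_
      split_ifs <;> simp
    · refine (sum_bernW_mul_indicator_le h0 P _).trans_eq ?_
      rw [card_pair]
      rintro rfl
      exact hx hw
  calc _ ≤ ∑ b, ∑ s, ∑ w ∈ T, ∑ y, f w y b s :=
        sum_le_sum fun b _ => sum_le_sum fun s _ => hpt b s
    _ = ∑ w ∈ T, ∑ y, ∑ b, ∑ s, f w y b s := by
        rw [sum_congr rfl fun b _ => sum_comm, sum_comm]
        refine sum_congr rfl fun w _ => ?_
        rw [sum_congr rfl fun b _ => sum_comm, sum_comm]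
    _ ≤ ∑ w ∈ T, ∑ _y : α, (p * p + p ^ 2) :=
        sum_le_sum fun w hw => sum_le_sum fun y _ => hf w hw y
    _ = _ := by
        simp only [sum_const, card_univ, nsmul_eq_mul]
        ring

end Bernoulli

section Conditional

variable {m : ℕ} {par : Fin m → Fin m} {r : Fin m}

/-- Conditionally on the tree, the probability that the strongly connected components differ is
controlled by the sizes of the subtrees at the heads of the permitted edges. -/
theorem sum_not_sameSCCs_le (ht : IsForest {r} par) {p : ℝ} (h0 : 0 ≤ p) (h1 : p ≤ 1) :
    ∑ b : Fin m → Fin m → Bool, ∑ s : Fin m → Fin m → Bool,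
      backW p par r b * surpW p par r s *
        (if ¬ SameSCCs (edgeX par r b s) (edgeXstar par r b) then 1 else 0) ≤
      ∑ x ∈ permitted par r, p * min 1 (2 * p * m * #(descend par x.2)) := by
  set Q := univ.filter (fun x : Fin m × Fin m => dfsPos par r x.2 < dfsPos par r x.1)
  have hback : ∀ b, backW p par r b = bernW p Q b := by
    intro b
    simp [backW, bernW, Q]
  have hsurp : ∀ s, surpW p par r s = bernW p (permitted par r) s := fun s => by
    simp [surpW, bernW]
  simp only [hback, hsurp]
  set P := permitted par r with hP
  obtain ⟨leave, hleave⟩ : ∃ L : Fin m → (Fin m → Fin m → Bool) → (Fin m → Fin m → Bool) → Prop,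
      ∀ v b s, L v b s ↔ ∃ w ∈ descend par v, ∃ y, b w y = true ∨ s w y = true :=
    ⟨_, fun _ _ _ => Iff.rfl⟩
  have hb0 := fun b => bernW_nonneg h0 h1 Q b
  have hs0 := fun s => bernW_nonneg h0 h1 P s
  have hpt : ∀ b s, bernW p Q b * bernW p P s *
      (if ¬ SameSCCs (edgeX par r b s) (edgeXstar par r b) then 1 else 0) ≤
      ∑ x ∈ P, bernW p Q b * bernW p P s *
        (if s x.1 x.2 = true ∧ leave x.2 b s then 1 else 0) := by
    intro b s
    have hnn : ∀ x ∈ P, 0 ≤ bernW p Q b * bernW p P s *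
        (if s x.1 x.2 = true ∧ leave x.2 b s then 1 else 0) := fun x _ =>
      mul_nonneg (mul_nonneg (hb0 b) (hs0 s)) (by split_ifs <;> simp)
    by_cases hgood : SameSCCs (edgeX par r b s) (edgeXstar par r b)
    · simpa [hgood] using sum_nonneg hnn
    by_cases hQ : ∀ u w, b u w = true → (u, w) ∈ Q
    swap
    · simp [bernW, hQ]
    by_cases hS : ∀ u w, s u w = true → (u, w) ∈ P
    swap
    · simp [bernW, hS]
    have hex : ∃ u v, s u v = true ∧ Relation.ReflTransGen (edgeX par r b s) v u := by
      by_contra hc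
      push Not at hc
      exact hgood (sameSCCs_of_forall_surplus ht (fun u w h => by simpa [Q] using hQ u w h) hc)
    obtain ⟨u, v, hsuv, hpath⟩ := hex
    have hmem := hS u v hsuv
    have hl : leave v b s := by
      obtain ⟨w, y, hw, -, hwy⟩ :=
        exists_edge_leaving hpath (below_of_mem_permitted ht hmem).2.2
      exact (hleave v b s).2 ⟨w, mem_descend.2 hw, y, hwy⟩
    refine le_trans ?_ (single_le_sum hnn hmem)
    rw [if_pos hgood, if_pos ⟨hsuv, hl⟩]
  refine (sum_le_sum fun b _ => sum_le_sum fun s _ => hpt b s).trans ?_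
  rw [sum_congr rfl fun b _ => sum_comm, sum_comm]
  refine sum_le_sum fun x hx => ?_
  have hA := sum_bernW_mul_le_mul_left h0 h1 P Q x (leave x.2)
  rw [mul_min_of_nonneg _ _ h0, mul_one]
  refine le_min ?_ ?_
  · convert hA using 6
  have hu := (below_of_mem_permitted ht (u := x.1) (v := x.2) hx).2.2
  have := sum_bernW_mul_exists_le h0 h1 P Q x (descend par x.2) (by rwa [mem_descend])
    (leave x.2) (fun b s h => (hleave _ b s).1 h)
  rw [Fintype.card_fin] at this
  convert this using 6

end Conditional
end RandomTree

namespace RandomTree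

section Splitting

variable {V : Type*}

/-- The restriction of `g` to an invariant set. -/
noncomputable def restr (q : V → Prop) (g : V → V) (x : Subtype q) : Subtype q :=
  if h : q (g x) then ⟨g x, h⟩ else x

theorem coe_restr {q : V → Prop} {g : V → V} (hq : ∀ x, q x → q (g x)) (x : Subtype q) :
    (restr q g x : V) = g x := by
  rw [restr, dif_pos (hq x x.2)]

theorem below_restr_iff {q : V → Prop} {g : V → V} (hq : ∀ x, q x → q (g x)) (x y : Subtype q) :
    Below (restr q g) x y ↔ Below g x y := by
  have h : ∀ k, ((restr q g)^[k] x : V) = g^[k] x := by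
    intro k
    induction k with
    | zero => rfl
    | succ k ih => rw [Function.iterate_succ_apply', Function.iterate_succ_apply', coe_restr hq, ih]
  refine exists_congr fun k => ?_
  rw [Subtype.ext_iff, h]

theorem Below.invariant {q : V → Prop} {g : V → V} (hq : ∀ x, q x → q (g x)) {x y : V}
    (h : Below g x y) (hx : q x) : q y := by
  obtain ⟨k, rfl⟩ := h
  induction k with
  | zero => exact hx
  | succ k ih => rw [Function.iterate_succ_apply']; exact hq _ ih

variable [Fintype V]

/-- The number of vertices on the path from `u` to its root. -/
noncomputable def pathSize (g : V → V) (u : V) : ℕ := #{y | Below g u y}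

theorem pathSize_restr {q : V → Prop} [DecidablePred q] {g : V → V} (hq : ∀ x, q x → q (g x))
    (u : Subtype q) : pathSize (restr q g) u = pathSize g u := by
  unfold pathSize
  refine card_bij (fun y _ => (y : V)) ?_ ?_ ?_
  · intro y hy
    simpa [below_restr_iff hq] using hy
  · intro y _ y' _ h
    exact Subtype.ext h
  · intro y hy
    simp only [mem_filter, mem_univ, true_and] at hy
    exact ⟨⟨y, hy.invariant hq u.2⟩, by simpa [below_restr_iff hq] using hy, rfl⟩

variable [DecidableEq V]

theorem sum_forests_pair_le {r v : V} (φ : ℕ → ℝ) (hφ : ∀ k, 0 ≤ φ k) {S : Finset V} (hv : v ∈ S)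
    (hr : r ∉ S) :
    ∑ g ∈ forests {v, r} with descend g v = S,
        φ #(descend g v) * ∑ u ∈ (descend g v)ᶜ, (pathSize g u : ℝ) ≤
      φ #S * (#(forests {(⟨v, hv⟩ : {x // x ∈ S})}) *
        ∑ g ∈ forests {(⟨r, hr⟩ : {x // x ∉ S})}, ∑ u, (pathSize g u : ℝ)) := by
  have hvr : v ≠ r := by rintro rfl; exact hr hv
  let f : (V → V) → ({x // x ∈ S} → {x // x ∈ S}) × ({x // x ∉ S} → {x // x ∉ S}) := fun g =>
    (restr (· ∈ S) g, restr (· ∉ S) g)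
  let s := (forests {v, r}).filter (fun g => descend g v = S)
  have hin : ∀ g ∈ s, IsForest {v, r} g ∧ (∀ x, x ∈ S ↔ Below g x v) ∧
      (∀ x, x ∈ S → g x ∈ S) ∧ (∀ x, x ∉ S → g x ∉ S) := by
    intro g hg
    rw [mem_filter, mem_forests] at hg
    obtain ⟨hg, hS⟩ := hg
    have hgv : g v = v := hg.1 v (by simp)
    have hmem : ∀ x, x ∈ S ↔ Below g x v := fun x => by rw [← hS, mem_descend]
    refine ⟨hg, hmem, fun x hx => ?_, fun x hx h => ?_⟩
    · rw [hmem] at hx ⊢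
      rcases hx.cases_step with rfl | h
      · rw [hgv]; exact Below.refl _ _
      · exact h
    · rw [hmem] at hx h
      exact hx ((Below.step g x).trans h)
  have hinj : Set.InjOn f s := by
    intro g hg g' hg' h
    obtain ⟨-, -, h1, h2⟩ := hin g hg
    obtain ⟨-, -, h1', h2'⟩ := hin g' hg'
    rw [Prod.mk.injEq] at h
    funext x
    by_cases hx : x ∈ S
    · have := congrArg (fun k => (k ⟨x, hx⟩ : V)) h.1
      simpa only [coe_restr h1, coe_restr h1'] using this
    · have := congrArg (fun k => (k ⟨x, hx⟩ : V)) h.2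
      simpa only [coe_restr h2, coe_restr h2'] using this
  have hval : ∀ g ∈ s, φ #(descend g v) * ∑ u ∈ (descend g v)ᶜ, (pathSize g u : ℝ) =
      φ #S * ∑ u, (pathSize (f g).2 u : ℝ) := by
    intro g hg
    obtain ⟨-, hmem, h1, h2⟩ := hin g hg
    have hS : descend g v = S := (mem_filter.1 hg).2
    rw [hS]
    congr 1
    refine (Finset.sum_subtype Sᶜ (p := fun x => x ∉ S) (by simp)
      (fun u => (pathSize g u : ℝ))).trans (sum_congr rfl fun u _ => ?_)
    rw [pathSize_restr h2]
  rw [sum_congr rfl hval, ← mul_sum]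
  refine mul_le_mul_of_nonneg_left ?_ (hφ _)
  rw [← sum_image (f := fun x : ({x // x ∈ S} → {x // x ∈ S}) × ({x // x ∉ S} → {x // x ∉ S}) =>
    ∑ u, (pathSize x.2 u : ℝ)) hinj]
  refine (sum_le_sum_of_subset_of_nonneg (t := forests {(⟨v, hv⟩ : {x // x ∈ S})} ×ˢ
    forests {(⟨r, hr⟩ : {x // x ∉ S})}) ?_ (fun _ _ _ => by positivity)).trans_eq ?_
  · intro x hx
    obtain ⟨g, hg, rfl⟩ := mem_image.1 hx
    obtain ⟨hgf, hmem, h1, h2⟩ := hin g hg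
    rw [mem_product, mem_forests, mem_forests]
    refine ⟨⟨?_, ?_⟩, ⟨?_, ?_⟩⟩
    · intro x hx
      rw [mem_singleton] at hx
      subst hx
      exact Subtype.ext ((coe_restr h1 _).trans (hgf.1 v (by simp)))
    · intro x
      exact ⟨_, mem_singleton_self _, (below_restr_iff h1 _ _).2 ((hmem x).1 x.2)⟩
    · intro x hx
      rw [mem_singleton] at hx
      subst hx
      exact Subtype.ext ((coe_restr h2 _).trans (hgf.1 r (by simp)))
    · intro x
      refine ⟨_, mem_singleton_self _, (below_restr_iff h2 _ _).2 ?_⟩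
      obtain ⟨ρ, hρ, h⟩ := hgf.2 x
      rw [mem_insert, mem_singleton] at hρ
      rcases hρ with rfl | rfl
      · exact absurd ((hmem x).2 h) x.2
      · exact h
  · rw [sum_product]
    simp only [sum_const, nsmul_eq_mul]

theorem sum_forests_fringe_le {r v : V} (hvr : v ≠ r) (φ : ℕ → ℝ) (hφ : ∀ k, 0 ≤ φ k) :
    ∑ g ∈ forests {r}, φ #(descend g v) * #{u | Below g u (g v) ∧ ¬ Below g u v} ≤
      ∑ g ∈ forests {v, r}, φ #(descend g v) * ∑ u ∈ (descend g v)ᶜ, (pathSize g u : ℝ) := by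
  rw [sum_forests_eq_sum_attach (R := {r}) (v := v) (by simpa using hvr)]
  refine sum_le_sum fun g _ => ?_
  have h1 : ∀ y ∈ (descend g v)ᶜ, φ #(descend (Function.update g v y) v) *
      #{u | Below (Function.update g v y) u (Function.update g v y v) ∧
        ¬ Below (Function.update g v y) u v} ≤
      φ #(descend g v) * #{u ∈ (descend g v)ᶜ | Below g u y} := by
    intro y _
    have hag : ∀ x, x ≠ v → Function.update g v y x = g x :=
      fun x hx => Function.update_of_ne hx _ _
    have hbel : ∀ x, Below (Function.update g v y) x v ↔ Below g x v := by
      intro x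
      constructor
      · intro h
        rcases h.transfer hag with h | ⟨h, -⟩ <;> exact h
      · intro h
        rcases h.transfer (fun x hx => (hag x hx).symm) with h | ⟨h, -⟩ <;> exact h
    have hd : descend (Function.update g v y) v = descend g v := by
      ext x; rw [mem_descend, mem_descend, hbel]
    rw [hd]
    refine mul_le_mul_of_nonneg_left ?_ (hφ _)
    rw [Nat.cast_le]
    refine card_le_card fun u hu => ?_
    simp only [mem_filter, mem_univ, true_and, mem_compl, mem_descend, Function.update_self,
      hbel] at hu ⊢
    refine ⟨hu.2, ?_⟩
    rcases hu.1.transfer hag with h | ⟨h, -⟩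
    · exact h
    · exact absurd h hu.2
  refine (sum_le_sum h1).trans ?_
  rw [← mul_sum]
  refine mul_le_mul_of_nonneg_left ?_ (hφ _)
  rw [← Nat.cast_sum, ← Nat.cast_sum, Nat.cast_le]
  have h2 := sum_card_bipartiteAbove_eq_sum_card_bipartiteBelow (s := (descend g v)ᶜ)
    (t := (descend g v)ᶜ) (Below g)
  simp only [bipartiteAbove, bipartiteBelow] at h2
  rw [← h2]
  exact sum_le_sum fun u _ => card_le_card (filter_subset_filter _ (subset_univ _))

theorem sum_forests_pair_eq {r v : V} (hvr : v ≠ r) (H : (V → V) → ℝ) :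
    ∑ g ∈ forests {v, r}, H g = ∑ S : Finset V with v ∈ S ∧ r ∉ S,
      ∑ g ∈ forests {v, r} with descend g v = S, H g := by
  rw [sum_fiberwise_of_maps_to]
  intro g hg
  rw [mem_forests] at hg
  simp only [mem_filter, mem_univ, true_and, mem_descend]
  refine ⟨Below.refl _ _, fun h => hvr ?_⟩
  exact h.eq_of_fixed (hg.1 r (by simp))

end Splitting

section PathSize

theorem pathSize_le_spread {V : Type*} [DecidableEq V] [Fintype V] (r : V) (g : V → V)
    (u : V) : pathSize g u ≤ spread {r} g u + 1 := by
  refine le_trans (card_le_card ?_) (card_insert_le r _)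
  intro y hy
  simp only [mem_filter, mem_univ, true_and, mem_insert, mem_compl, mem_singleton] at hy ⊢
  by_cases hyr : y = r
  · exact Or.inl hyr
  · exact Or.inr ⟨hyr, Or.inr (hy.trans (Below.step g y))⟩

/-- The total path length of all labelled trees on `n` vertices is of order `n ^ (n - 1 / 2)`. -/
theorem exists_pathSize_bound : ∃ C > (0 : ℝ),
    ∀ (V : Type) [DecidableEq V] [Fintype V] (r : V),
      ∑ g ∈ forests {r}, ∑ u, (pathSize g u : ℝ) ≤
        C * √(Fintype.card V) * ((Fintype.card V : ℝ) ^ Fintype.card V / Fintype.card V) := by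
  obtain ⟨C, hC, h⟩ := exists_spread_bound 1 zero_le_one
  refine ⟨C, hC, fun V _ _ r => ?_⟩
  have h1 := h V r
  set n := Fintype.card V
  have hn : (1 : ℝ) ≤ n := by exact_mod_cast Fintype.card_pos_iff.2 ⟨r⟩
  have hs : 1 ≤ √(n : ℝ) := Real.one_le_sqrt.2 hn
  have key : ∀ g u, (pathSize g u : ℝ) ≤ √n * (1 + 1 / √n) ^ spread {r} g u := by
    intro g u
    have h2 : (pathSize g u : ℝ) ≤ spread {r} g u + 1 := by
      exact_mod_cast pathSize_le_spread r g u
    have h3 := one_add_mul_le_pow (a := 1 / √(n : ℝ)) (by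
      have : 0 ≤ 1 / √(n : ℝ) := by positivity
      linarith) (spread {r} g u)
    calc (pathSize g u : ℝ) ≤ spread {r} g u + √n := by linarith
      _ = √n * (1 + spread {r} g u * (1 / √n)) := by field_simp; ring
      _ ≤ _ := by gcongr
  calc _ ≤ ∑ g ∈ forests {r}, ∑ u, √n * (1 + 1 / √n) ^ spread {r} g u :=
        sum_le_sum fun g _ => sum_le_sum fun u _ => key g u
    _ = √n * ∑ g ∈ forests {r}, ∑ u, (1 + 1 / √n) ^ spread {r} g u := by
        simp only [mul_sum]
    _ ≤ √n * (C * (n : ℝ) ^ n / n) := by gcongr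
    _ = _ := by ring

end PathSize
end RandomTree

namespace RandomTree

section Estimates

theorem factorial_le_exp_mul (n : ℕ) (hn : n ≠ 0) :
    (n.factorial : ℝ) ≤ Real.exp 1 * √n * (n / Real.exp 1) ^ n := by
  have h := Stirling.stirlingSeq'_antitone (Nat.zero_le (n - 1))
  simp only [Function.comp_apply, Nat.succ_eq_add_one, zero_add, Stirling.stirlingSeq_one,
    Nat.sub_add_cancel (Nat.one_le_iff_ne_zero.2 hn)] at h
  rw [Stirling.stirlingSeq, div_le_div_iff₀ (by positivity) (by positivity)] at h
  have h2 : √(2 * (n : ℝ)) = √2 * √n := Real.sqrt_mul zero_le_two _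
  rw [h2] at h
  have h3 : 0 < √(2 : ℝ) := by positivity
  nlinarith

theorem choose_mul_pow_le {n k : ℕ} (hk : k ≠ 0) (hkn : k < n) :
    (n.choose k : ℝ) * (k : ℝ) ^ k * ((n - k : ℕ) : ℝ) ^ (n - k) * (√k * √(n - k : ℕ)) ≤
      Real.exp 1 * √n * (n : ℝ) ^ n := by
  have hlow : ∀ j : ℕ, √j * (j / Real.exp 1) ^ j ≤ (j.factorial : ℝ) := by
    intro j
    refine le_trans ?_ (Stirling.le_factorial_stirling j)
    gcongr
    have := Real.pi_gt_three
    nlinarith [Nat.cast_nonneg (α := ℝ) j]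
  have h1 := hlow k
  have h2 := hlow (n - k)
  have h3 := factorial_le_exp_mul n (by omega)
  have h4 : (n.choose k : ℝ) * k.factorial * (n - k).factorial = n.factorial := by
    exact_mod_cast Nat.choose_mul_factorial_mul_factorial hkn.le
  have he : Real.exp 1 ^ k * Real.exp 1 ^ (n - k) = Real.exp 1 ^ n := by
    rw [← pow_add, Nat.add_sub_cancel' hkn.le]
  have hpos : 0 < Real.exp 1 ^ n := by positivity
  rw [div_pow] at h1 h2 h3
  have h5 : (n.choose k : ℝ) * (√k * ((k : ℝ) ^ k / Real.exp 1 ^ k)) *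
      (√(n - k : ℕ) * (((n - k : ℕ) : ℝ) ^ (n - k) / Real.exp 1 ^ (n - k))) ≤
      Real.exp 1 * √n * ((n : ℝ) ^ n / Real.exp 1 ^ n) := by
    refine le_trans ?_ (h4.trans_le h3)
    gcongr
  have h6 := mul_le_mul_of_nonneg_right h5 hpos.le
  calc _ = (n.choose k : ℝ) * (√k * ((k : ℝ) ^ k / Real.exp 1 ^ k)) *
      (√(n - k : ℕ) * (((n - k : ℕ) : ℝ) ^ (n - k) / Real.exp 1 ^ (n - k))) *
        Real.exp 1 ^ n := by
        rw [← he]; field_simp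
    _ ≤ _ := h6
    _ = _ := by field_simp

theorem choose_pred_mul {n k : ℕ} (hkn : k < n) :
    ((n - 1).choose k : ℝ) * n = n.choose k * (n - k : ℕ) := by
  obtain ⟨n, rfl⟩ : ∃ j, n = j + 1 := ⟨n - 1, by omega⟩
  rw [Nat.add_sub_cancel]
  exact_mod_cast Nat.choose_mul_succ_eq n k

/-- The summand of `exists_fringe_bound` coming from the fringe subtrees of size `k`. -/
theorem choose_pred_mul_fringe_le {n k : ℕ} (hk : k ≠ 0) (hkn : k < n) {C : ℝ} (hC : 0 ≤ C) :
    ((n - 1).choose k : ℝ) * (k * ((k : ℝ) ^ (1 / 4 : ℝ) * ((k : ℝ) ^ k / (k : ℝ) ^ 2 *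
        (C * √(n - k : ℕ) * (((n - k : ℕ) : ℝ) ^ (n - k) / (n - k : ℕ)))))) ≤
      C * Real.exp 1 * ((n : ℝ) ^ n / √n) * (k : ℝ) ^ (-(5 / 4) : ℝ) := by
  have h1 := choose_pred_mul hkn
  have h2 := choose_mul_pow_le hk hkn
  have hn : (0 : ℝ) < n := by exact_mod_cast (by omega : 0 < n)
  have hk' : (0 : ℝ) < k := by exact_mod_cast Nat.pos_of_ne_zero hk
  have hj : (0 : ℝ) < (n - k : ℕ) := by exact_mod_cast (by omega : 0 < n - k)
  set j : ℝ := ((n - k : ℕ) : ℝ) with hjdef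
  have h3 : ((n - 1).choose k : ℝ) = n.choose k * j / n := by
    rw [eq_div_iff hn.ne']; exact h1
  have h4 : (k : ℝ) ^ (1 / 4 : ℝ) = k ^ (-(5 / 4) : ℝ) * (k * √k) := by
    rw [Real.sqrt_eq_rpow]
    nth_rewrite 3 [← Real.rpow_one (k : ℝ)]
    rw [← Real.rpow_add hk', ← Real.rpow_add hk']
    norm_num
  have h5 : √(n : ℝ) * √n = n := Real.mul_self_sqrt hn.le
  have hsn : 0 < √(n : ℝ) := Real.sqrt_pos.2 hn
  calc _ = C / n * (k : ℝ) ^ (-(5 / 4) : ℝ) *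
        ((n.choose k : ℝ) * (k : ℝ) ^ k * j ^ (n - k) * (√k * √j)) := by
        rw [h3, h4]; field_simp
    _ ≤ C / n * (k : ℝ) ^ (-(5 / 4) : ℝ) * (Real.exp 1 * √n * (n : ℝ) ^ n) := by gcongr
    _ = _ := by
        nth_rewrite 1 [← h5]
        field_simp

/-- A bound for the expected number of pairs counted with the size of a fringe subtree. -/
theorem exists_fringe_bound : ∃ C > (0 : ℝ), ∀ (V : Type) [DecidableEq V] [Fintype V] (r : V),
    ∑ g ∈ forests {r}, ∑ v ∈ {r}ᶜ, (#(descend g v) : ℝ) ^ (1 / 4 : ℝ) *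
        #{u | Below g u (g v) ∧ ¬ Below g u v} ≤
      C * ((Fintype.card V : ℝ) ^ Fintype.card V / √(Fintype.card V)) := by
  obtain ⟨C, hC, hb⟩ := exists_pathSize_bound
  have hsum : Summable fun k : ℕ => (k : ℝ) ^ (-(5 / 4) : ℝ) :=
    Real.summable_nat_rpow.2 (by norm_num)
  have hsum0 : 0 ≤ ∑' k : ℕ, (k : ℝ) ^ (-(5 / 4) : ℝ) :=
    tsum_nonneg fun k => Real.rpow_nonneg k.cast_nonneg _
  refine ⟨C * Real.exp 1 * (∑' k : ℕ, (k : ℝ) ^ (-(5 / 4) : ℝ) + 1), by positivity, ?_⟩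
  intro V _ _ r
  set n := Fintype.card V with hn
  have hn0 : 0 < n := Fintype.card_pos_iff.2 ⟨r⟩
  set φ : ℕ → ℝ := fun k => (k : ℝ) ^ (1 / 4 : ℝ) with hφ
  have hφ0 : ∀ k, 0 ≤ φ k := fun k => Real.rpow_nonneg k.cast_nonneg _
  set ψ : ℕ → ℝ := fun k => φ k * ((k : ℝ) ^ k / (k : ℝ) ^ 2 *
        (C * √(n - k : ℕ) * (((n - k : ℕ) : ℝ) ^ (n - k) / (n - k : ℕ)))) with hψ
  have hS : ∀ v ∈ ({r}ᶜ : Finset V), ∀ S : Finset V, v ∈ S ∧ r ∉ S →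
      ∑ g ∈ forests {v, r} with descend g v = S,
        φ #(descend g v) * ∑ u ∈ (descend g v)ᶜ, (pathSize g u : ℝ) ≤ ψ #S := by
    rintro v - S ⟨hv, hr⟩
    refine (sum_forests_pair_le φ hφ0 hv hr).trans ?_
    refine mul_le_mul_of_nonneg_left ?_ (hφ0 _)
    have hS0 : (0 : ℝ) < #S := by exact_mod_cast card_pos.2 ⟨v, hv⟩
    have hcard := card_forests_singleton (⟨v, hv⟩ : {x // x ∈ S})
    rw [Fintype.card_coe] at hcard
    have h2 := hb {x // x ∉ S} ⟨r, hr⟩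
    have h3 : Fintype.card {x // x ∉ S} = n - #S := by
      rw [Fintype.card_subtype_compl, Fintype.card_coe]
    rw [h3] at h2
    refine mul_le_mul (le_of_eq ?_) ?_ (sum_nonneg fun _ _ => sum_nonneg fun _ _ =>
      Nat.cast_nonneg _) (by positivity)
    · rw [eq_div_iff (by positivity)]
      convert hcard using 3
    · convert h2 using 3
  have hswap : ∑ v ∈ ({r}ᶜ : Finset V), ∑ S : Finset V with v ∈ S ∧ r ∉ S, ψ #S =
      ∑ S ∈ ({r}ᶜ : Finset V).powerset, (#S : ℝ) * ψ #S := by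
    rw [sum_comm' (t' := ({r}ᶜ : Finset V).powerset) (s' := fun S => S)]
    · simp [sum_const, nsmul_eq_mul]
    · intro v S
      simp only [mem_compl, mem_singleton, mem_filter, mem_univ, true_and, mem_powerset]
      constructor
      · rintro ⟨-, h1, h2⟩
        refine ⟨h1, fun x hx => ?_⟩
        simp only [mem_compl, mem_singleton]
        rintro rfl
        exact h2 hx
      · rintro ⟨h1, h2⟩
        have := h2 h1
        simp only [mem_compl, mem_singleton] at this
        refine ⟨this, h1, fun h => ?_⟩
        have := h2 h
        simp at this
  have hcardc : #({r}ᶜ : Finset V) = n - 1 := by rw [card_compl, card_singleton]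
  calc _ = ∑ v ∈ ({r}ᶜ : Finset V), ∑ g ∈ forests {r}, φ #(descend g v) *
        #{u | Below g u (g v) ∧ ¬ Below g u v} := sum_comm
    _ ≤ ∑ v ∈ ({r}ᶜ : Finset V), ∑ S : Finset V with v ∈ S ∧ r ∉ S, ψ #S := by
        refine sum_le_sum fun v hv => ?_
        have hvr : v ≠ r := by simpa using hv
        refine (sum_forests_fringe_le hvr φ hφ0).trans ?_
        rw [sum_forests_pair_eq hvr]
        exact sum_le_sum fun S hS' => hS v hv S (by simpa using hS')
    _ = ∑ k ∈ range n, ((n - 1).choose k : ℝ) * (k * ψ k) := by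
        rw [hswap, sum_powerset_apply_card (fun k => (k : ℝ) * ψ k), hcardc,
          Nat.sub_add_cancel hn0]
        simp [nsmul_eq_mul]
    _ ≤ ∑ k ∈ range n, C * Real.exp 1 * ((n : ℝ) ^ n / √n) * (k : ℝ) ^ (-(5 / 4) : ℝ) := by
        refine sum_le_sum fun k hk => ?_
        rcases eq_or_ne k 0 with rfl | hk0
        · simp only [Nat.cast_zero, zero_mul, mul_zero]
          positivity
        · exact choose_pred_mul_fringe_le hk0 (mem_range.1 hk) hC.le
    _ = C * Real.exp 1 * ((n : ℝ) ^ n / √n) * ∑ k ∈ range n, (k : ℝ) ^ (-(5 / 4) : ℝ) := by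
        rw [mul_sum]
    _ ≤ C * Real.exp 1 * ((n : ℝ) ^ n / √n) * (∑' k : ℕ, (k : ℝ) ^ (-(5 / 4) : ℝ) + 1) := by
        gcongr
        exact (hsum.sum_le_tsum _ fun k _ => Real.rpow_nonneg k.cast_nonneg _).trans
          (by linarith)
    _ = _ := by ring

end Estimates
end RandomTree

namespace RandomTree

section Assembly

variable {m : ℕ} {par : Fin m → Fin m} {r : Fin m}

theorem area_le_sum_spread (ht : IsForest {r} par) :
    area par r ≤ ∑ u, spread {r} par u := by
  have h1 : permitted par r ⊆
      univ.filter fun x : Fin m × Fin m => x.2 ∈ ({r}ᶜ : Finset (Fin m)) ∧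
        (par x.2 ∈ ({r} : Finset (Fin m)) ∨ Below par x.1 (par x.2)) := by
    rintro ⟨u, v⟩ h
    have := below_of_mem_permitted ht h
    simp [this.1, this.2.1]
  refine (card_le_card h1).trans (le_of_eq ?_)
  rw [card_filter, Fintype.sum_prod_type]
  refine sum_congr rfl fun u _ => ?_
  rw [spread, ← card_filter]
  congr 1
  ext v
  simp

theorem sum_permitted_le_fringe (ht : IsForest {r} par) {p : ℝ} (h0 : 0 ≤ p) :
    ∑ x ∈ permitted par r, p * min 1 (2 * p * m * #(descend par x.2)) ≤
      p * (2 * p * m) ^ (1 / 4 : ℝ) * ∑ v ∈ {r}ᶜ, (#(descend par v) : ℝ) ^ (1 / 4 : ℝ) *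
        #{u | Below par u (par v) ∧ ¬ Below par u v} := by
  have hmin : ∀ t : ℝ, 0 ≤ t → min 1 t ≤ t ^ (1 / 4 : ℝ) := by
    intro t ht0
    rcases le_total 1 t with h | h
    · exact (min_le_left _ _).trans (Real.one_le_rpow h (by norm_num))
    · refine (min_le_right _ _).trans ?_
      have := Real.rpow_le_rpow_of_exponent_ge' ht0 h (by norm_num : (0 : ℝ) ≤ 1 / 4)
        (by norm_num : (1 / 4 : ℝ) ≤ 1)
      rwa [Real.rpow_one] at this
  have hsub : permitted par r ⊆
      univ.filter fun x : Fin m × Fin m => x.2 ∈ ({r}ᶜ : Finset (Fin m)) ∧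
        (Below par x.1 (par x.2) ∧ ¬ Below par x.1 x.2) := by
    rintro ⟨u, v⟩ h
    have := below_of_mem_permitted ht h
    simp [this.1, this.2.1, this.2.2]
  calc _ ≤ ∑ x ∈ permitted par r,
        p * ((2 * p * m) ^ (1 / 4 : ℝ) * (#(descend par x.2) : ℝ) ^ (1 / 4 : ℝ)) := by
        refine sum_le_sum fun x _ => mul_le_mul_of_nonneg_left ?_ h0
        rw [← Real.mul_rpow (by positivity) (by positivity)]
        exact hmin _ (by positivity)
    _ ≤ ∑ x : Fin m × Fin m with x.2 ∈ ({r}ᶜ : Finset (Fin m)) ∧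
          (Below par x.1 (par x.2) ∧ ¬ Below par x.1 x.2),
        p * ((2 * p * m) ^ (1 / 4 : ℝ) * (#(descend par x.2) : ℝ) ^ (1 / 4 : ℝ)) :=
        sum_le_sum_of_subset_of_nonneg hsub fun _ _ _ => by positivity
    _ = _ := by
        rw [sum_filter, Fintype.sum_prod_type_right, mul_sum, ← sum_subset (subset_univ ({r}ᶜ : Finset (Fin m)))]
        · refine sum_congr rfl fun v hv => ?_
          simp only [hv, true_and]
          rw [← sum_filter, sum_const, nsmul_eq_mul]
          ring
        · intro v _ hv
          simp [hv]

/-- Convexity turns the exponential of the number of permitted edges into an average. -/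
theorem inv_pow_sum_spread_le (hm : 0 < m) {p κ : ℝ} (h0 : 0 ≤ p) (h1 : p ≤ 1 / 2)
    (hκ : p * (m * √m) ≤ κ) :
    ((1 - p)⁻¹) ^ (3 * ∑ u, spread {r} par u) ≤
      (1 / m : ℝ) * ∑ u, (1 + 6 * κ * Real.exp (6 * κ) / √m) ^ spread {r} par u := by
  have hm' : (0 : ℝ) < m := by exact_mod_cast hm
  have hm1 : (1 : ℝ) ≤ m := by exact_mod_cast hm
  have hs : 0 < √(m : ℝ) := Real.sqrt_pos.2 hm'
  have hs1 : 1 ≤ √(m : ℝ) := Real.one_le_sqrt.2 hm1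
  have hκ0 : 0 ≤ κ := le_trans (by positivity) hκ
  have hy : (1 - p)⁻¹ ≤ Real.exp (2 * p) := by
    refine le_trans ?_ (Real.add_one_le_exp _)
    rw [inv_le_iff_one_le_mul₀ (by linarith)]
    nlinarith
  have ht : 6 * p * m ≤ 6 * κ / √m := by
    rw [le_div_iff₀ hs]; nlinarith
  have htκ : 6 * κ / √m ≤ 6 * κ := div_le_self (by positivity) hs1
  have hexp : Real.exp (6 * p * m) ≤ 1 + 6 * κ * Real.exp (6 * κ) / √m := by
    set t := 6 * κ / √(m : ℝ) with htdef
    have ht0 : 0 ≤ t := by positivity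
    have h2 := Real.add_one_le_exp (-t)
    have h3 : Real.exp (-t) * Real.exp t = 1 := by rw [← Real.exp_add]; simp
    have h4 : Real.exp t ≤ 1 + t * Real.exp t := by nlinarith [Real.exp_pos t]
    calc _ ≤ Real.exp t := Real.exp_le_exp.2 ht
      _ ≤ 1 + t * Real.exp t := h4
      _ ≤ 1 + t * Real.exp (6 * κ) := by gcongr
      _ = _ := by rw [htdef]; ring
  have hconv := convexOn_exp.map_sum_le (t := (univ : Finset (Fin m)))
    (w := fun _ => (1 / m : ℝ)) (p := fun u => (spread {r} par u : ℝ) * (6 * p * m))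
    (fun _ _ => by positivity) (by simp [hm'.ne']) (fun _ _ => Set.mem_univ _)
  calc _ ≤ Real.exp (2 * p) ^ (3 * ∑ u, spread {r} par u) := by
        have : 0 ≤ (1 - p)⁻¹ := inv_nonneg.2 (by linarith)
        gcongr
    _ = Real.exp (∑ u, (1 / m : ℝ) • ((spread {r} par u : ℝ) * (6 * p * m))) := by
        rw [← Real.exp_nat_mul]
        congr 1
        simp only [smul_eq_mul]
        rw [← mul_sum, ← sum_mul]
        push_cast
        field_simp
        ring
    _ ≤ _ := hconv
    _ = (1 / m : ℝ) * ∑ u, Real.exp (6 * p * m) ^ spread {r} par u := by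
        simp only [smul_eq_mul, Real.exp_nat_mul, ← mul_sum]
    _ ≤ _ := by gcongr

theorem sum_permitted_mul_sq_le (ht : IsForest {r} par) {p : ℝ} (h0 : 0 ≤ p) (h1 : p ≤ 1 / 2) :
    (∑ x ∈ permitted par r, p * min 1 (2 * p * m * #(descend par x.2))) *
        (((1 - p) ^ area par r)⁻¹) ^ 2 ≤
      ((1 - p)⁻¹) ^ (3 * ∑ u, spread {r} par u) := by
  set A := ∑ u, spread {r} par u with hA
  have hp : 0 < 1 - p := by linarith
  have hy : 1 + p ≤ (1 - p)⁻¹ := by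
    rw [← one_div, le_div_iff₀ hp]
    nlinarith
  have hy1 : 1 ≤ (1 - p)⁻¹ := by linarith
  have hpow : ((1 - p)⁻¹) ^ area par r ≤ ((1 - p)⁻¹) ^ A :=
    pow_le_pow_right₀ hy1 (area_le_sum_spread ht)
  have hsum : ∑ x ∈ permitted par r, p * min 1 (2 * p * m * #(descend par x.2)) ≤
      ((1 - p)⁻¹) ^ A :=
    calc _ ≤ ∑ x ∈ permitted par r, p := by
          refine sum_le_sum fun x _ => ?_
          nlinarith [min_le_left 1 (2 * p * m * (#(descend par x.2) : ℝ))]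
      _ = area par r * p := by simp [area]
      _ ≤ 1 + area par r * p := by linarith
      _ ≤ (1 + p) ^ area par r := one_add_mul_le_pow (by linarith) _
      _ ≤ ((1 - p)⁻¹) ^ area par r := by gcongr
      _ ≤ _ := hpow
  rw [← inv_pow]
  calc _ ≤ ((1 - p)⁻¹) ^ A * (((1 - p)⁻¹) ^ A) ^ 2 := by gcongr
    _ = _ := by ring

end Assembly

theorem modelProb_mul_le {m : ℕ} {p : ℝ} (hm : 0 < m) (h0 : 0 ≤ p) (h1 : p < 1) :
    modelProb m p (fun _ par r b s => ¬ SameSCCs (edgeX par r b s) (edgeXstar par r b)) *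
        ((m : ℝ) ^ m / (m : ℝ) ^ 2) ≤
      ∑ par ∈ forests {(⟨0, hm⟩ : Fin m)}, ((1 - p) ^ area par ⟨0, hm⟩)⁻¹ *
        ∑ x ∈ permitted par ⟨0, hm⟩, p * min 1 (2 * p * m * #(descend par x.2)) := by
  have hm' : (0 : ℝ) < m := by exact_mod_cast hm
  have hp : 0 < 1 - p := by linarith
  rw [modelProb, dif_pos hm]
  set r : Fin m := ⟨0, hm⟩
  have hM0 : 0 < (m : ℝ) ^ m / (m : ℝ) ^ 2 := by positivity
  have hbias : ∀ H : (Fin m → Fin m) → ℝ,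
      ∑ par, biasW p par r * H par =
        ∑ par ∈ forests {r}, ((1 - p) ^ area par r)⁻¹ * H par := by
    intro H
    rw [forests, sum_filter]
    refine sum_congr rfl fun par _ => ?_
    simp only [biasW, isForest_singleton_iff]
    split_ifs <;> simp
  have hD : (m : ℝ) ^ m / (m : ℝ) ^ 2 ≤ ∑ par, biasW p par r := by
    have h2 := hbias fun _ => 1
    simp only [mul_one] at h2
    have h3 := card_forests_singleton r
    rw [Fintype.card_fin] at h3
    rw [h2, div_le_iff₀ (by positivity), ← h3]
    refine mul_le_mul_of_nonneg_right ?_ (by positivity)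
    rw [← nsmul_one, ← sum_const]
    refine sum_le_sum fun par _ => ?_
    exact (one_le_inv₀ (by positivity)).2 (pow_le_one₀ hp.le (by linarith))
  have hN : ∑ par : Fin m → Fin m, ∑ b : Fin m → Fin m → Bool, ∑ s : Fin m → Fin m → Bool,
      biasW p par r * backW p par r b * surpW p par r s *
        (if ¬ SameSCCs (edgeX par r b s) (edgeXstar par r b) then (1 : ℝ) else 0) ≤
      ∑ par ∈ forests {r}, ((1 - p) ^ area par r)⁻¹ *
        ∑ x ∈ permitted par r, p * min 1 (2 * p * m * #(descend par x.2)) := by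
    have h3 : ∀ par : Fin m → Fin m, ∑ b : Fin m → Fin m → Bool, ∑ s : Fin m → Fin m → Bool,
        biasW p par r * backW p par r b * surpW p par r s *
          (if ¬ SameSCCs (edgeX par r b s) (edgeXstar par r b) then (1 : ℝ) else 0) =
        biasW p par r * ∑ b : Fin m → Fin m → Bool, ∑ s : Fin m → Fin m → Bool,
          backW p par r b * surpW p par r s *
          (if ¬ SameSCCs (edgeX par r b s) (edgeXstar par r b) then (1 : ℝ) else 0) := by
      intro par
      rw [mul_sum]
      refine sum_congr rfl fun b _ => ?_
      rw [mul_sum]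
      refine sum_congr rfl fun s _ => ?_
      ring
    rw [sum_congr rfl fun par _ => h3 par, hbias]
    refine sum_le_sum fun par hpar => mul_le_mul_of_nonneg_left ?_ (by positivity)
    exact sum_not_sameSCCs_le (mem_forests.1 hpar) h0 h1.le
  have hD0 := hM0.trans_le hD
  rw [div_mul_eq_mul_div, div_le_iff₀ hD0]
  refine mul_le_mul (le_trans (le_of_eq ?_) hN) hD hM0.le (sum_nonneg fun par _ => mul_nonneg ?_ ?_)
  · refine sum_congr rfl fun par _ => sum_congr rfl fun b _ => sum_congr rfl fun s _ => ?_
    congr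
  · exact inv_nonneg.2 (pow_nonneg hp.le _)
  · exact sum_nonneg fun x _ => mul_nonneg h0 (le_min zero_le_one (by positivity))

theorem sum_mul_le_sqrt {ι : Type*} (s : Finset ι) {f w : ι → ℝ}
    (hf : ∀ i, 0 ≤ f i) (hw : ∀ i, 0 ≤ w i) :
    ∑ i ∈ s, w i * f i ≤ √((∑ i ∈ s, f i) * ∑ i ∈ s, f i * w i ^ 2) := by
  rw [Real.sqrt_mul (sum_nonneg fun i _ => hf i)]
  refine le_trans (le_of_eq ?_) (Real.sum_sqrt_mul_sqrt_le s hf fun i =>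
    mul_nonneg (hf i) (sq_nonneg (w i)))
  refine sum_congr rfl fun i _ => ?_
  rw [Real.sqrt_mul (hf i), Real.sqrt_sq (hw i), ← mul_assoc, Real.mul_self_sqrt (hf i), mul_comm]

theorem exists_modelProb_le (κ : ℝ) (hκ : 0 < κ) : ∃ C > (0 : ℝ), ∀ (m : ℕ) (p : ℝ), 0 < m →
    0 ≤ p → p ≤ 1 / 2 → p * (m * √m) ≤ κ →
    modelProb m p (fun _ par r b s => ¬ SameSCCs (edgeX par r b s) (edgeXstar par r b)) ≤
      √(C * (2 * κ / √m) ^ (1 / 4 : ℝ)) := by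
  obtain ⟨C₁, hC₁, hfr⟩ := exists_fringe_bound
  obtain ⟨C₂, hC₂, hsp⟩ := exists_spread_bound (6 * κ * Real.exp (6 * κ)) (by positivity)
  refine ⟨κ * C₁ * C₂, by positivity, ?_⟩
  intro m p hm h0 h1 hpκ
  have hm' : (0 : ℝ) < m := by exact_mod_cast hm
  have hs : 0 < √(m : ℝ) := Real.sqrt_pos.2 hm'
  have hss : √(m : ℝ) * √m = m := Real.mul_self_sqrt hm'.le
  have hp : 0 < 1 - p := by linarith
  have hmain := modelProb_mul_le hm h0 (by linarith : p < 1)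
  generalize hP : modelProb m p
    (fun _ par r b s => ¬ SameSCCs (edgeX par r b s) (edgeXstar par r b)) = P at hmain ⊢
  generalize (⟨0, hm⟩ : Fin m) = r at hmain
  have hM0 : 0 < (m : ℝ) ^ m / (m : ℝ) ^ 2 := by positivity
  have hsumf : ∑ par ∈ forests {r}, ∑ x ∈ permitted par r,
      p * min 1 (2 * p * m * (#(descend par x.2) : ℝ)) ≤
      κ * C₁ * (2 * κ / √m) ^ (1 / 4 : ℝ) * ((m : ℝ) ^ m / (m : ℝ) ^ 2) := by
    have h2 := hfr (Fin m) r
    rw [Fintype.card_fin] at h2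
    have h3 : 2 * p * m ≤ 2 * κ / √m := by rw [le_div_iff₀ hs]; nlinarith
    calc _ ≤ p * (2 * p * m) ^ (1 / 4 : ℝ) * (C₁ * ((m : ℝ) ^ m / √m)) := by
          refine (sum_le_sum fun par hpar =>
            sum_permitted_le_fringe (mem_forests.1 hpar) h0).trans ?_
          rw [← mul_sum]
          refine mul_le_mul_of_nonneg_left ?_ (by positivity)
          convert h2 using 3
      _ = (p * (m * √m)) * C₁ * (2 * p * m) ^ (1 / 4 : ℝ) * ((m : ℝ) ^ m / (m : ℝ) ^ 2) := by
          have : (m : ℝ) ^ m / √m = m * √m * ((m : ℝ) ^ m / (m : ℝ) ^ 2) := by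
            generalize (m : ℝ) ^ m = X
            rw [div_eq_iff hs.ne', show (m : ℝ) * √m * (X / (m : ℝ) ^ 2) * √m =
              m * (√m * √m) * (X / (m : ℝ) ^ 2) by ring, hss]
            field_simp
          rw [this]; ring
      _ ≤ _ := by gcongr
  have hsumw : ∑ par ∈ forests {r}, (∑ x ∈ permitted par r,
      p * min 1 (2 * p * m * (#(descend par x.2) : ℝ))) * (((1 - p) ^ area par r)⁻¹) ^ 2 ≤
      C₂ * ((m : ℝ) ^ m / (m : ℝ) ^ 2) := by
    have h2 := hsp (Fin m) r
    rw [Fintype.card_fin] at h2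
    calc _ ≤ ∑ par ∈ forests {r}, (1 / m : ℝ) *
          ∑ u, (1 + 6 * κ * Real.exp (6 * κ) / √m) ^ spread {r} par u :=
          sum_le_sum fun par hpar =>
            (sum_permitted_mul_sq_le (mem_forests.1 hpar) h0 h1).trans
              (inv_pow_sum_spread_le hm h0 h1 hpκ)
      _ ≤ (1 / m : ℝ) * (C₂ * (m : ℝ) ^ m / m) := by
          rw [← mul_sum]
          refine mul_le_mul_of_nonneg_left ?_ (by positivity)
          convert h2 using 3
      _ = _ := by
          generalize (m : ℝ) ^ m = X
          ring
  generalize (m : ℝ) ^ m / (m : ℝ) ^ 2 = M at *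
  refine le_of_mul_le_mul_right (hmain.trans ((sum_mul_le_sqrt (forests {r}) (fun par =>
    sum_nonneg fun x _ => by positivity) fun par => by positivity).trans ?_)) hM0
  calc _ ≤ √((κ * C₁ * (2 * κ / √m) ^ (1 / 4 : ℝ) * M) * (C₂ * M)) :=
        Real.sqrt_le_sqrt (mul_le_mul hsumf hsumw (sum_nonneg fun par _ => by positivity)
          (by positivity))
    _ = √(κ * C₁ * C₂ * (2 * κ / √m) ^ (1 / 4 : ℝ) * M ^ 2) := by congr 1; ring
    _ = _ := by rw [Real.sqrt_mul (by positivity), Real.sqrt_sq hM0.le]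

theorem modelProb_nonneg {m : ℕ} {p : ℝ} (h0 : 0 ≤ p) (h1 : p ≤ 1)
    (ev : ∀ m' : ℕ, (Fin m' → Fin m') → Fin m' →
      (Fin m' → Fin m' → Bool) → (Fin m' → Fin m' → Bool) → Prop) : 0 ≤ modelProb m p ev := by
  have hp : 0 ≤ 1 - p := by linarith
  have hbias : ∀ par r, 0 ≤ biasW (m := m) p par r := fun par r => by
    unfold biasW; split_ifs <;> positivity
  have hq : ∀ c : Prop, [Decidable c] → 0 ≤ (if c then p else 1 - p) := fun c _ => by
    split_ifs <;> assumption
  unfold modelProb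
  split_ifs with h
  · refine div_nonneg (sum_nonneg fun par _ => sum_nonneg fun b _ => sum_nonneg fun s _ => ?_)
      (sum_nonneg fun par _ => hbias par _)
    refine mul_nonneg (mul_nonneg (mul_nonneg (hbias par _) ?_) ?_) ?_
    · unfold backW
      split_ifs
      · exact prod_nonneg fun x _ => hq _
      · exact le_rfl
    · unfold surpW
      split_ifs
      · exact prod_nonneg fun x _ => hq _
      · exact le_rfl
    · split_ifs <;> norm_num
  · exact le_rfl

end RandomTree

open RandomTree Filter in
/-- Fix `σ > 0` and `p = p(m)` with `m · p(m)^{2/3} → σ`.  Then the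
probability that `X_m` (the random directed graph built from the biased tree `T_m` with
back and surplus edges added independently with probability `p(m)`) and `X_m*` (the tree
together with only the marked back edges) have different strongly connected components
tends to `0` as `m → ∞`. -/
theorem prob_scc_differ_tendsto_zero
    (σ : ℝ) (hσ : 0 < σ) (p : ℕ → ℝ) (hp : ∀ m, 0 ≤ p m ∧ p m ≤ 1)
    (hσlim : Tendsto (fun m : ℕ => (m : ℝ) * (p m) ^ ((2:ℝ)/3)) atTop (nhds σ)) :
    Tendsto (fun m : ℕ => modelProb m (p m)
      (fun m' par r b s => ¬ SameSCCs (edgeX par r b s) (edgeXstar par r b)))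
      atTop (nhds 0) := by
  set κ : ℝ := (σ + 1) * √(σ + 1) with hκdef
  have hκ : 0 < κ := by positivity
  obtain ⟨C, hC, hbound⟩ := exists_modelProb_le κ hκ
  have hpκ : ∀ᶠ m : ℕ in atTop, p m * (m * √m) ≤ κ := by
    filter_upwards [hσlim.eventually_le_const (lt_add_one σ)] with m hm
    have h0 := (hp m).1
    have h2 : p m * (m * √m) = (m * p m ^ ((2 : ℝ) / 3)) * √(m * p m ^ ((2 : ℝ) / 3)) := by
      have h3 : p m = p m ^ ((2 : ℝ) / 3) * √(p m ^ ((2 : ℝ) / 3)) := by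
        rw [Real.sqrt_eq_rpow, ← Real.rpow_mul h0, ← Real.rpow_add' h0 (by norm_num)]
        norm_num
      rw [Real.sqrt_mul (Nat.cast_nonneg m)]
      nth_rewrite 1 [h3]
      ring
    rw [h2, hκdef]
    gcongr
  have hsqrt : Tendsto (fun m : ℕ => √(m : ℝ)) atTop atTop :=
    Real.tendsto_sqrt_atTop.comp tendsto_natCast_atTop_atTop
  have hhalf : ∀ᶠ m : ℕ in atTop, p m ≤ 1 / 2 := by
    filter_upwards [hpκ, tendsto_natCast_atTop_atTop.eventually_ge_atTop (2 * κ),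
      eventually_ge_atTop 1] with m h1 h2 h3
    have h4 : (1 : ℝ) ≤ m := by exact_mod_cast h3
    have h5 : 1 ≤ √(m : ℝ) := Real.one_le_sqrt.2 h4
    have h6 := (hp m).1
    have h7 : p m * m ≤ κ := le_trans (by gcongr; nlinarith) h1
    have h8 : p m * (2 * κ) ≤ κ := le_trans (by gcongr) h7
    nlinarith
  have hlim : Tendsto (fun m : ℕ => √(C * (2 * κ / √(m : ℝ)) ^ (1 / 4 : ℝ))) atTop (nhds 0) := by
    have h1 : Tendsto (fun m : ℕ => 2 * κ / √(m : ℝ)) atTop (nhds 0) :=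
      tendsto_const_nhds.div_atTop hsqrt
    have h2 := ((h1.rpow_const (Or.inr (by norm_num : (0 : ℝ) ≤ 1 / 4))).const_mul C).sqrt
    simpa using h2
  refine squeeze_zero' (Eventually.of_forall fun m => modelProb_nonneg (hp m).1 (hp m).2 _) ?_ hlim
  filter_upwards [hpκ, hhalf, eventually_gt_atTop 0] with m h1 h2 h3
  exact hbound m (p m) h3 (hp m).1 h2 h1
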